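/- arXiv:2212.00324 — 2 statements merged into one kernel-verified Lean document; each statement's English description precedes it below -/
import Mathlib

section
/- Let K and L be number fields of degrees n and m respectively. Then the real number m·log|d_K| − n·log|d_L| + (π/2)·(n·r₁(L) − m·r₁(K)) is either zero or transcendental. (This is the key step of Theorem 6: this number equals −2(m·ζ_K'(1/2)/ζ_K(1/2) − n·ζ_L'(1/2)/ζ_L(1/2)) whenever ζ_K(1/2)ζ_L(1/2) ≠ 0.) -/
noncomputable section BakerAux

open Polynomial

/-- `(d/dX + c)^m X^x`, defined recursively. -/
def qp {R : Type*} [CommRing R] (c : R) : ℕ → ℕ → R[X]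
  | 0, x => X ^ x
  | (m + 1), x => C (x : R) * qp c m (x - 1) + C c * qp c m x

lemma qp_natDegree {R : Type*} [CommRing R] (c : R) (m x : ℕ) : (qp c m x).natDegree ≤ x := by
  induction m generalizing x with
  | zero => simpa [qp] using natDegree_X_pow_le (R := R) x
  | succ m ih =>
    rw [qp]
    refine (natDegree_add_le _ _).trans (max_le ?_ ?_)
    · exact (natDegree_C_mul_le _ _).trans ((ih _).trans (Nat.sub_le _ _))
    · exact (natDegree_C_mul_le _ _).trans (ih _)

lemma qp_coeff {R : Type*} [CommRing R] (c : R) (m x : ℕ) : (qp c m x).coeff x = c ^ m := by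
  induction m generalizing x with
  | zero => simp [qp]
  | succ m ih =>
    rw [qp, coeff_add, coeff_C_mul, coeff_C_mul, ih]
    rcases Nat.eq_zero_or_pos x with h | h
    · subst h; simp; ring
    · rw [coeff_eq_zero_of_natDegree_lt (p := qp c m (x - 1))]
      · ring
      · exact (qp_natDegree c m (x - 1)).trans_lt (by omega)

lemma qp_map_eval {R S : Type*} [CommRing R] [CommRing S] (f : R →+* S) (c : R) (m x l : ℕ) :
    f ((qp c m x).eval (l : R)) = (qp (f c) m x).eval (l : S) := by
  induction m generalizing x with
  | zero => simp [qp]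
  | succ m ih => simp [qp, ih]

lemma qp_bound (c z : ℂ) (r : ℝ) (hr : 1 ≤ r) (hz : ‖z‖ ≤ r) (m x : ℕ) :
    ‖(qp c m x).eval z‖ ≤ (x + ‖c‖) ^ m * r ^ x := by
  induction m generalizing x with
  | zero => simpa [qp] using pow_le_pow_left₀ (norm_nonneg z) hz x
  | succ m ih =>
    rw [qp]
    simp only [eval_add, eval_mul, eval_C]
    have h1 := ih (x - 1)
    have h2 := ih x
    have h3 : ((x - 1 : ℕ) + ‖c‖) ^ m * r ^ (x - 1) ≤ (x + ‖c‖) ^ m * r ^ x := by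
      have : ((x - 1 : ℕ) : ℝ) ≤ x := by exact_mod_cast Nat.sub_le x 1
      have h4 : r ^ (x - 1) ≤ r ^ x := pow_le_pow_right₀ hr (Nat.sub_le x 1)
      gcongr
    calc _ ≤ ‖(x : ℂ) * (qp c m (x - 1)).eval z‖ + ‖c * (qp c m x).eval z‖ := norm_add_le _ _
      _ = x * ‖(qp c m (x - 1)).eval z‖ + ‖c‖ * ‖(qp c m x).eval z‖ := by simp
      _ ≤ x * ((x + ‖c‖) ^ m * r ^ x) + ‖c‖ * ((x + ‖c‖) ^ m * r ^ x) := by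
        gcongr
        exact h1.trans h3
      _ = _ := by ring

lemma qp_deriv (c z : ℂ) (m x : ℕ) :
    HasDerivAt (fun z => (qp c m x).eval z)
      ((qp c (m + 1) x).eval z - c * (qp c m x).eval z) z := by
  induction m generalizing x with
  | zero => simpa [qp] using hasDerivAt_pow x z
  | succ m ih =>
    have h := ((ih (x - 1)).const_mul (x : ℂ)).add ((ih x).const_mul c)
    have e : (fun z => (qp c (m + 1) x).eval z) = (fun y => (x : ℂ) * eval y (qp c m (x - 1))) +
        fun y => c * eval y (qp c m x) := by
      funext z; simp [qp]
    rw [e]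
    refine h.congr_deriv ?_
    simp only [qp, eval_add, eval_mul, eval_C]
    ring

/-- The family of exponential polynomials. -/
def Phi {ι : Type*} [Fintype ι] (b g ω : ℂ) (X Y W : ι → ℕ) (p : ι → ℂ) (m n : ℕ) (z : ℂ) : ℂ :=
  ∑ i, p i * (qp (b * W i) m (X i)).eval z * (Y i + g * W i) ^ n *
    Complex.exp ((Y i * ω + (b + g * ω) * W i) * z)

lemma Phi_deriv {ι : Type*} [Fintype ι] (b g ω : ℂ) (X Y W : ι → ℕ) (p : ι → ℂ) (m n : ℕ) (z : ℂ) :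
    HasDerivAt (Phi b g ω X Y W p m n)
      (Phi b g ω X Y W p (m + 1) n z + ω * Phi b g ω X Y W p m (n + 1) z) z := by
  unfold Phi
  rw [Finset.mul_sum, ← Finset.sum_add_distrib]
  apply HasDerivAt.fun_sum
  intro i _
  have h1 := qp_deriv (b * W i) z m (X i)
  have h2 : HasDerivAt (fun z => Complex.exp ((Y i * ω + (b + g * ω) * W i) * z))
      (Complex.exp ((Y i * ω + (b + g * ω) * W i) * z) * (Y i * ω + (b + g * ω) * W i)) z := by
    simpa using ((hasDerivAt_id z).const_mul (Y i * ω + (b + g * ω) * W i : ℂ)).cexp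
  have h3 := (((h1.const_mul (p i)).mul_const ((Y i + g * W i : ℂ) ^ n))).mul h2
  refine h3.congr_deriv ?_
  ring

lemma Phi_diff {ι : Type*} [Fintype ι] (b g ω : ℂ) (X Y W : ι → ℕ) (p : ι → ℂ) (m n : ℕ) :
    Differentiable ℂ (Phi b g ω X Y W p m n) :=
  fun z => (Phi_deriv b g ω X Y W p m n z).differentiableAt

lemma Phi_iter {ι : Type*} [Fintype ι] (b g ω : ℂ) (X Y W : ι → ℕ) (p : ι → ℂ) (z : ℂ) (T : ℕ)
    (k m n : ℕ) (hm : m + k < T) (hn : n + k < T)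
    (h : ∀ m < T, ∀ n < T, Phi b g ω X Y W p m n z = 0) :
    iteratedDeriv k (Phi b g ω X Y W p m n) z = 0 := by
  induction k generalizing m n with
  | zero => simpa using h m (by omega) n (by omega)
  | succ k ih =>
    have : deriv (Phi b g ω X Y W p m n) =
        Phi b g ω X Y W p (m + 1) n + ω • Phi b g ω X Y W p m (n + 1) := by
      funext z; simpa using (Phi_deriv b g ω X Y W p m n z).deriv
    rw [iteratedDeriv_succ', this, iteratedDeriv_add, iteratedDeriv_const_smul_field,
      ih (m + 1) n (by omega) (by omega), ih m (n + 1) (by omega) (by omega)]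
    · simp
    · exact (Phi_diff b g ω X Y W p (m + 1) n).contDiff.contDiffAt
    · exact ((Phi_diff b g ω X Y W p m (n + 1)).const_smul ω).contDiff.contDiffAt

lemma exists_div_pow (f : ℂ → ℂ) (hf : Differentiable ℂ f) (c : ℂ) (T : ℕ)
    (h : (T : ℕ∞) ≤ analyticOrderAt f c) :
    ∃ g : ℂ → ℂ, Differentiable ℂ g ∧ ∀ z, f z = (z - c) ^ T * g z := by
  induction T generalizing f with
  | zero => exact ⟨f, hf, by simp⟩
  | succ T ih =>
    have hfa : AnalyticAt ℂ f c := hf.analyticAt c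
    have hf0 : f c = 0 := by
      apply apply_eq_zero_of_analyticOrderAt_ne_zero
      intro h0
      rw [h0] at h
      simp at h
    have hd : Differentiable ℂ (dslope f c) := by
      rw [← differentiableOn_univ]
      exact (Complex.differentiableOn_dslope Filter.univ_mem).2 hf.differentiableOn
    have heq : ∀ z, f z = (z - c) * dslope f c z := by
      intro z
      have := sub_smul_dslope f c z
      rw [hf0] at this
      simpa using this.symm
    obtain ⟨g, hg, hgz⟩ := ih (dslope f c) hd (by
      have h1 : f = (fun z => z - c) * dslope f c := by funext z; exact heq z
      rw [h1, analyticOrderAt_mul (by fun_prop) (hd.analyticAt c)] at h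
      have h2 : analyticOrderAt (fun z : ℂ => z - c) c = 1 := by
        simp
      rw [h2] at h
      push_cast at h
      rw [add_comm] at h
      exact (ENat.add_le_add_iff_left (by simp)).1 h)
    refine ⟨g, hg, fun z => ?_⟩
    rw [heq, hgz]; ring

lemma exists_div_prod (f : ℂ → ℂ) (hf : Differentiable ℂ f) (S T : ℕ)
    (h : ∀ l < S, (T : ℕ∞) ≤ analyticOrderAt f (l : ℂ)) :
    ∃ g : ℂ → ℂ, Differentiable ℂ g ∧
      ∀ z, f z = (∏ l ∈ Finset.range S, (z - (l : ℂ)) ^ T) * g z := by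
  induction S with
  | zero => exact ⟨f, hf, by simp⟩
  | succ S ih =>
    obtain ⟨g, hg, hgz⟩ := ih fun l hl => h l (by omega)
    obtain ⟨g', hg', hgz'⟩ := exists_div_pow g hg (S : ℂ) T (by
      have h0 := h S (by omega)
      have h1 : f = (fun z => ∏ l ∈ Finset.range S, (z - (l : ℂ)) ^ T) * g := by
        funext z; simpa using hgz z
      have hp : AnalyticAt ℂ (fun z : ℂ => ∏ l ∈ Finset.range S, (z - (l : ℂ)) ^ T) S := by
        apply Differentiable.analyticAt
        fun_prop
      have h2 : analyticOrderAt (fun z : ℂ => ∏ l ∈ Finset.range S, (z - (l : ℂ)) ^ T) S = 0 := by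
        rw [hp.analyticOrderAt_eq_zero]
        refine Finset.prod_ne_zero_iff.2 fun l hl => pow_ne_zero _ ?_
        rw [sub_ne_zero]
        have := Finset.mem_range.1 hl
        exact_mod_cast (by omega : S ≠ l)
      rwa [h1, analyticOrderAt_mul hp (hg.analyticAt _), h2, zero_add] at h0)
    refine ⟨g', hg', fun z => ?_⟩
    rw [hgz, hgz', Finset.prod_range_succ]; ring

/-- Schwarz lemma with many zeros. -/
lemma schwarz_many (f : ℂ → ℂ) (hf : Differentiable ℂ f) (S T : ℕ)
    (h : ∀ l < S, ∀ k < T, iteratedDeriv k f (l : ℂ) = 0) (r R M : ℝ) (hr : 0 < r) (hS : S ≤ r)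
    (hR : 4 * r ≤ R) (hM : ∀ z, ‖z‖ ≤ R → ‖f z‖ ≤ M) (z : ℂ) (hz : ‖z‖ ≤ r) :
    ‖f z‖ ≤ M * (4 * r / R) ^ (S * T) := by
  obtain ⟨g, hg, hgz⟩ := exists_div_prod f hf S T fun l hl =>
    (natCast_le_analyticOrderAt_iff_iteratedDeriv_eq_zero (hf.analyticAt _)).2 (h l hl)
  have hR0 : 0 < R := by linarith
  have hM0 : 0 ≤ M := (norm_nonneg _).trans (hM 0 (by simp; linarith))
  have hprod : ∀ z : ℂ, ‖∏ l ∈ Finset.range S, (z - (l : ℂ)) ^ T‖ =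
      ∏ l ∈ Finset.range S, ‖z - (l : ℂ)‖ ^ T := by
    intro z; simp [norm_prod]
  have hl : ∀ l ∈ Finset.range S, ‖(l : ℂ)‖ ≤ r := by
    intro l hl
    have := Finset.mem_range.1 hl
    rw [Complex.norm_natCast]
    have : (l : ℝ) ≤ S := by exact_mod_cast this.le
    linarith
  have hgb : ∀ w ∈ Metric.closedBall (0 : ℂ) R, ‖g w‖ ≤ M / (R / 2) ^ (S * T) := by
    intro w hw
    refine Complex.norm_le_of_forall_mem_frontier_norm_le (U := Metric.ball (0 : ℂ) R)
      Metric.isBounded_ball hg.diffContOnCl ?_ ?_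
    · intro w hw
      rw [frontier_ball _ (by linarith : R ≠ 0)] at hw
      have hw' : ‖w‖ = R := by simpa using hw
      rw [le_div_iff₀ (by positivity), mul_comm]
      have h1 := hM w hw'.le
      rw [hgz, norm_mul, hprod] at h1
      refine le_trans ?_ h1
      gcongr
      calc (R / 2) ^ (S * T) = ∏ l ∈ Finset.range S, (R / 2) ^ T := by
            simp [← pow_mul, mul_comm]
        _ ≤ _ := by
          refine Finset.prod_le_prod (fun _ _ => by positivity) fun l hl' => ?_
          have := norm_sub_norm_le w (l : ℂ)
          have := hl l hl'
          have : R / 2 ≤ ‖w - (l : ℂ)‖ := by linarith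
          gcongr
    · rwa [closure_ball _ (by linarith : R ≠ 0)]
  have h2 := hgb z (by simp; linarith)
  rw [hgz, norm_mul, hprod]
  calc _ ≤ (∏ l ∈ Finset.range S, (2 * r) ^ T) * (M / (R / 2) ^ (S * T)) := by
        gcongr with l hl'
        have := norm_sub_le z (l : ℂ)
        have := hl l hl'
        linarith
    _ = (2 * r) ^ (S * T) * (M / (R / 2) ^ (S * T)) := by simp [← pow_mul, mul_comm]
    _ = _ := by
      rw [show 4 * r / R = (2 * r) / (R / 2) by field_simp; ring, div_pow (2 * r)]; ring


lemma zero_exp_poly {ι : Type*} (s : Finset ι) (a : ι → ℂ) (ha0 : ∀ i, a i ≠ 0)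
    (hinj : Function.Injective a) (D : ℕ) : ∀ (d : ι → ℕ) (G : ι → ℂ[X]),
    (∑ i ∈ s, d i = D) → (∀ i ∈ s, (G i).degree < d i) →
    (∀ l < D, ∑ i ∈ s, a i ^ l * (G i).eval (l : ℂ) = 0) → ∀ i ∈ s, G i = 0 := by
  classical
  induction D with
  | zero =>
    intro d G hd hG _ i hi
    have : d i = 0 := by
      have := Finset.sum_eq_zero_iff.1 hd i hi
      exact this
    have h := hG i hi
    rw [this] at h
    simpa [Nat.WithBot.lt_zero_iff] using h
  | succ D ih =>
    intro d G hd hG hv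
    obtain ⟨i0, hi0, hdi0⟩ : ∃ i ∈ s, 0 < d i := by
      by_contra! hcon
      have : ∑ i ∈ s, d i = 0 := Finset.sum_eq_zero fun i hi => by simpa using hcon i hi
      omega
    -- the new family
    have hcomp : ∀ i ∈ s, ((G i).comp (X + C 1)).degree < d i := by
      intro i hi
      have : (G i).comp (X + C 1) = taylor 1 (G i) := by rw [taylor_apply]
      rw [this, degree_taylor]
      exact hG i hi
    have key := ih (Function.update d i0 (d i0 - 1))
      (fun i => C (a i) * (G i).comp (X + C 1) - C (a i0) * G i) ?_ ?_ ?_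
    · -- conclude
      have hne : ∀ i ∈ s, i ≠ i0 → G i = 0 := by
        intro i hi hii
        by_contra hGi
        have h1 := key i hi
        have h2 := congrArg (fun q => coeff q (G i).natDegree) h1
        have h3 : ((G i).comp (X + C 1)).coeff (G i).natDegree = (G i).leadingCoeff := by
          have : (G i).comp (X + C 1) = taylor 1 (G i) := by rw [taylor_apply]
          rw [this, coeff_taylor_natDegree]
        simp only [coeff_sub, coeff_C_mul, h3, coeff_natDegree, coeff_zero] at h2
        rw [← sub_mul, mul_eq_zero, sub_eq_zero] at h2
        rcases h2 with h2 | h2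
        · exact hii (hinj h2)
        · exact hGi (leadingCoeff_eq_zero.1 h2)
      have hc : (G i0).comp (X + C 1) = G i0 := by
        have h1 := key i0 hi0
        rw [← mul_sub, mul_eq_zero] at h1
        rcases h1 with h1 | h1
        · exact absurd (C_eq_zero.1 h1) (ha0 i0)
        · exact sub_eq_zero.1 h1
      have h0 := hv 0 (by omega)
      rw [Finset.sum_eq_single_of_mem i0 hi0 (fun i hi hii => by rw [hne i hi hii]; simp)] at h0
      have h0' : (G i0).eval 0 = 0 := by simpa using h0
      have hall : ∀ n : ℕ, (G i0).eval (n : ℂ) = 0 := by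
        intro n
        induction n with
        | zero => simpa using h0'
        | succ n ihn =>
          have := congrArg (eval (n : ℂ)) hc
          simp only [eval_comp, eval_add, eval_X, eval_C] at this
          push_cast
          rw [this, ihn]
      have hz : G i0 = 0 := by
        apply Polynomial.eq_zero_of_infinite_isRoot
        refine Set.Infinite.mono (s := Set.range (fun n : ℕ => (n : ℂ))) ?_ ?_
        · rintro _ ⟨n, rfl⟩
          exact hall n
        · exact Set.infinite_range_of_injective Nat.cast_injective
      intro i hi
      by_cases hii : i = i0
      · rw [hii]; exact hz
      · exact hne i hi hii
    · rw [Finset.sum_update_of_mem hi0]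
      rw [← Finset.add_sum_erase s d hi0] at hd
      rw [Finset.sdiff_singleton_eq_erase]
      omega
    · intro i hi
      by_cases hii : i = i0
      · subst hii
        rw [Function.update_self, ← mul_sub]
        have hlt : ((G i).comp (X + C 1) - G i).degree < ((d i - 1 : ℕ) : WithBot ℕ) := by
          by_cases hG0 : G i = 0
          · rw [hG0]; simp
          have h1 : (G i).natDegree < d i := by
            rw [natDegree_lt_iff_degree_lt hG0]; exact hG i hi
          have ht : (G i).comp (X + C 1) = taylor 1 (G i) := by rw [taylor_apply]
          have h2 : ((G i).comp (X + C 1) - G i).degree < (G i).degree := by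
            have := degree_sub_lt_left (p := (G i).comp (X + C 1)) (q := G i)
              (by rw [ht, degree_taylor]) (by rw [ht]; simpa using hG0)
              (by rw [ht]; simp)
            rwa [ht, degree_taylor, ← ht] at this
          rw [degree_eq_natDegree hG0] at h2
          refine lt_of_lt_of_le h2 ?_
          exact_mod_cast (by omega : (G i).natDegree ≤ d i - 1)
        refine lt_of_le_of_lt ?_ hlt
        exact (degree_C_mul (ha0 i)).le
      · rw [Function.update_of_ne hii]
        refine lt_of_le_of_lt (degree_sub_le _ _) (max_lt ?_ ?_)
        · exact lt_of_le_of_lt (degree_C_mul (ha0 i)).le (hcomp i hi)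
        · exact lt_of_le_of_lt (degree_C_mul (ha0 i0)).le (hG i hi)
    · intro l hl
      have h1 := hv l (by omega)
      have h2 := hv (l + 1) (by omega)
      have : ∑ i ∈ s, a i ^ l * eval (l : ℂ) (C (a i) * (G i).comp (X + C 1) - C (a i0) * G i) =
          (∑ i ∈ s, a i ^ (l + 1) * (G i).eval ((l + 1 : ℕ) : ℂ)) -
          a i0 * ∑ i ∈ s, a i ^ l * (G i).eval (l : ℂ) := by
        rw [Finset.mul_sum, ← Finset.sum_sub_distrib]
        refine Finset.sum_congr rfl fun i _ => ?_
        simp only [eval_sub, eval_mul, eval_C, eval_comp, eval_add, eval_X]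
        push_cast
        ring
      rw [this, h1, h2]; simp

lemma zero_vander {L0 L : ℕ} (v : Fin L → ℂ) (hv : Function.Injective v)
    (h : ℕ → ℕ → Fin L → ℂ[X]) (hdeg : ∀ m x w, (h m x w).natDegree ≤ x)
    (hco : ∀ m x w, (h m x w).coeff x = v w ^ m) (p : Fin L0 → Fin L → ℂ)
    (hs : ∀ m < L, ∑ x : Fin L0, ∑ w : Fin L, C (p x w) * h m x w = 0) : ∀ x w, p x w = 0 := by
  have main : ∀ (k : ℕ) (x : Fin L0), L0 - x ≤ k → ∀ w, p x w = 0 := by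
    intro k
    induction k with
    | zero => intro x hx; have := x.2; omega
    | succ k ih =>
      intro x hx
      have hz : (fun w => p x w) = 0 := by
        apply Matrix.eq_zero_of_forall_pow_sum_mul_pow_eq_zero hv
        intro m
        have h1 := congrArg (fun q => coeff q (x : ℕ)) (hs m m.2)
        simp only [finsetSum_coeff, coeff_C_mul, coeff_zero] at h1
        rw [Finset.sum_eq_single x] at h1
        · simpa [hco] using h1
        · intro x' _ hx'
          refine Finset.sum_eq_zero fun w _ => ?_
          rcases lt_or_gt_of_ne hx' with hlt | hgt
          · rw [coeff_eq_zero_of_natDegree_lt ((hdeg _ _ _).trans_lt hlt), mul_zero]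
          · rw [ih x' (by have := x.2; have : (x : ℕ) < x' := hgt; omega) w, zero_mul]
        · simp
      exact fun w => congrFun hz w
  exact fun x w => main L0 x (Nat.sub_le _ _) w

/-- Index set of the auxiliary function. -/
abbrev Idx (L0 L : ℕ) := Fin L0 × Fin L × Fin L

/-- The auxiliary function. -/
def PhiI {L0 L : ℕ} (b g ω : ℂ) (p : Idx L0 L → ℂ) (m n : ℕ) (z : ℂ) : ℂ :=
  Phi b g ω (fun i : Idx L0 L => (i.1 : ℕ)) (fun i => (i.2.1 : ℕ)) (fun i => (i.2.2 : ℕ)) p m n z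

lemma PhiI_nat {L0 L : ℕ} (b g ω A : ℂ) (k : ℤ) (hA : Complex.exp ω = A)
    (hk : b + g * ω = 2 * Real.pi * Complex.I * k) (p : Idx L0 L → ℂ) (m n l : ℕ) :
    PhiI b g ω p m n l = ∑ i : Idx L0 L, p i *
      (qp (b * (i.2.2 : ℕ)) m (i.1 : ℕ)).eval (l : ℂ) * (((i.2.1 : ℕ) : ℂ) + g * (i.2.2 : ℕ)) ^ n *
      (A ^ (i.2.1 : ℕ)) ^ l := by
  unfold PhiI Phi
  refine Finset.sum_congr rfl fun i _ => ?_
  congr 1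
  rw [hk, add_mul, Complex.exp_add]
  have h1 : Complex.exp (2 * Real.pi * Complex.I * k * ((i.2.2 : ℕ) : ℂ) * (l : ℂ)) = 1 := by
    rw [Complex.exp_eq_one_iff]
    exact ⟨k * (i.2.2 : ℕ) * l, by push_cast; ring⟩
  rw [h1, mul_one, ← hA, ← Complex.exp_nat_mul, ← Complex.exp_nat_mul]
  congr 1
  ring

lemma final_zero {L0 L : ℕ} (hL : 0 < L) (b g ω : ℂ) (a : ℝ) (ha : 0 < a) (ha1 : a ≠ 1) (k : ℤ)
    (hA : Complex.exp ω = a)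
    (hk : b + g * ω = 2 * Real.pi * Complex.I * k) (hbg : b ≠ 0 ∨ g ≠ 0) (p : Idx L0 L → ℂ)
    (h : ∀ l < L0 * L, ∀ m < L, ∀ n < L, PhiI b g ω p m n l = 0) : p = 0 := by
  -- polynomials vanish
  have hG : ∀ m < L, ∀ n < L, ∀ y : Fin L, ∑ x : Fin L0, ∑ w : Fin L,
      C (p (x, y, w)) * (C (((y : ℕ) + g * (w : ℕ) : ℂ) ^ n) * qp (b * (w : ℕ)) m x) = 0 := by
    intro m hm n hn y
    have hinj : Function.Injective (fun y : Fin L => (a : ℂ) ^ (y : ℕ)) := by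
      intro y y' hyy
      have h1 : a ^ (y : ℕ) = a ^ (y' : ℕ) := by
        have : ((a ^ (y : ℕ) : ℝ) : ℂ) = ((a ^ (y' : ℕ) : ℝ) : ℂ) := by push_cast; exact hyy
        exact_mod_cast this
      exact Fin.ext (pow_right_injective₀ ha ha1 h1)
    refine zero_exp_poly (Finset.univ : Finset (Fin L)) (fun y => (a : ℂ) ^ (y : ℕ)) ?_ hinj (L0 * L)
      (fun _ => L0) (fun y => ∑ x : Fin L0, ∑ w : Fin L,
      C (p (x, y, w)) * (C (((y : ℕ) + g * (w : ℕ) : ℂ) ^ n) * qp (b * (w : ℕ)) m x)) ?_ ?_ ?_ y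
      (Finset.mem_univ _)
    · intro y
      exact pow_ne_zero _ (by exact_mod_cast ha.ne')
    · simp [mul_comm]
    · intro y _
      rw [← mem_degreeLT]
      refine Submodule.sum_mem _ fun x _ => Submodule.sum_mem _ fun w _ => ?_
      rw [← mul_assoc, ← C_mul, ← smul_eq_C_mul]
      refine Submodule.smul_mem _ _ ?_
      rw [mem_degreeLT]
      refine lt_of_le_of_lt (degree_le_of_natDegree_le (qp_natDegree _ m x)) ?_
      exact_mod_cast x.2
    · intro l hl
      have := h l hl m hm n hn
      rw [PhiI_nat b g ω a k hA hk] at this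
      rw [← this, Fintype.sum_prod_type, Finset.sum_congr rfl fun x _ => Fintype.sum_prod_type _,
        Finset.sum_comm]
      refine Finset.sum_congr rfl fun y _ => ?_
      rw [eval_finsetSum, Finset.mul_sum]
      refine Finset.sum_congr rfl fun x _ => ?_
      rw [eval_finsetSum, Finset.mul_sum]
      refine Finset.sum_congr rfl fun w _ => ?_
      simp only [eval_mul, eval_C]
      ring
  funext ⟨x, y, w⟩
  rcases eq_or_ne g 0 with hg | hg
  · have hb : b ≠ 0 := by tauto
    refine zero_vander (L0 := L0) (L := L) (fun w => b * (w : ℕ)) ?_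
      (fun m x w => qp (b * (w : ℕ)) m x) (fun m x w => qp_natDegree _ _ _)
      (fun m x w => qp_coeff _ _ _) (fun x w => p (x, y, w)) ?_ x w
    · intro w w' hww
      have := mul_left_cancel₀ hb hww
      exact Fin.ext (by exact_mod_cast this)
    · intro m hm
      have := hG m hm 0 hL y
      simpa using this
  · refine zero_vander (L0 := L0) (L := L) (fun w => (y : ℕ) + g * (w : ℕ)) ?_
      (fun m x w => C (((y : ℕ) + g * (w : ℕ) : ℂ) ^ m) * X ^ x) ?_ ?_ (fun x w => p (x, y, w)) ?_ x w
    · intro w w' hww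
      have := mul_left_cancel₀ hg (add_left_cancel hww)
      exact Fin.ext (by exact_mod_cast this)
    · intro m x w
      exact natDegree_C_mul_X_pow_le _ _
    · intro m x w
      rw [coeff_C_mul, coeff_X_pow_self, mul_one]
    · intro m hm
      have := hG 0 hL m hm y
      simpa [qp] using this

/-- Integral coefficients. -/
def coef {R : Type*} [CommRing R] (b g : R) (P Q L m n l x y w : ℕ) : R :=
  (qp (b * (w : R)) m x).eval (l : R) * ((y : R) + g * (w : R)) ^ n *
    (P : R) ^ (y * l) * (Q : R) ^ ((L - y) * l)

lemma coef_map {R S : Type*} [CommRing R] [CommRing S] (f : R →+* S) (b g : R)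
    (P Q L m n l x y w : ℕ) :
    f (coef b g P Q L m n l x y w) = coef (f b) (f g) P Q L m n l x y w := by
  unfold coef
  simp [qp_map_eval]

lemma PhiI_coef {L0 L : ℕ} (b g ω : ℂ) (P Q : ℕ) (hQ : Q ≠ 0) (k : ℤ)
    (hA : Complex.exp ω = (P : ℂ) / Q)
    (hk : b + g * ω = 2 * Real.pi * Complex.I * k) (p : Idx L0 L → ℂ) (m n l : ℕ) :
    ∑ i : Idx L0 L, coef b g P Q L m n l i.1 i.2.1 i.2.2 * p i =
      (Q : ℂ) ^ (L * l) * PhiI b g ω p m n l := by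
  rw [PhiI_nat b g ω _ k hA hk, Finset.mul_sum]
  refine Finset.sum_congr rfl fun i _ => ?_
  unfold coef
  have hy : (i.2.1 : ℕ) ≤ L := i.2.1.2.le
  have hQ' : (Q : ℂ) ≠ 0 := by exact_mod_cast hQ
  have : L * l = (i.2.1 : ℕ) * l + (L - (i.2.1 : ℕ)) * l := by
    rw [← add_mul]; congr 1; omega
  rw [this, pow_add, ← pow_mul, div_pow]
  field_simp


lemma U_mono (N j : ℕ) (hN : 1 ≤ N) : ((N : ℝ) ^ N ^ 9) ≤ (N : ℝ) ^ N ^ (9 + j) := by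
  apply pow_le_pow_right₀ (by exact_mod_cast hN)
  exact Nat.pow_le_pow_right hN (by omega)

lemma base_bound (N : ℕ) (hN : 338 ≤ N) (b g z : ℂ) (hb : ‖b‖ ≤ N) (hg : ‖g‖ ≤ N)
    (hz : ‖z‖ ≤ (N : ℝ) ^ 17) (m n x y w : ℕ) (hm : m ≤ N ^ 9) (hn : n ≤ N ^ 9)
    (hx : x < N ^ 9) (hy : y < N ^ 5) (hw : w < N ^ 5) :
    ‖(qp (b * (w : ℂ)) m x).eval z * ((y : ℂ) + g * (w : ℂ)) ^ n‖ ≤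
      ((N : ℝ) ^ N ^ 9) ^ 34 := by
  have hNr : (338 : ℝ) ≤ N := by exact_mod_cast hN
  have hN1 : (1 : ℝ) ≤ N := by linarith
  have hx' : (x : ℝ) ≤ (N : ℝ) ^ 9 := by exact_mod_cast hx.le
  have hy' : (y : ℝ) ≤ (N : ℝ) ^ 5 := by exact_mod_cast hy.le
  have hw' : (w : ℝ) ≤ (N : ℝ) ^ 5 := by exact_mod_cast hw.le
  have h6 : (N : ℝ) ^ 6 ≤ (N : ℝ) ^ 9 := pow_le_pow_right₀ hN1 (by norm_num)
  have h5 : (N : ℝ) ^ 5 ≤ (N : ℝ) ^ 6 := pow_le_pow_right₀ hN1 (by norm_num)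
  have h1 := qp_bound (b * (w : ℂ)) z ((N : ℝ) ^ 17) (one_le_pow₀ hN1) hz m x
  have e1 : (x + ‖b * (w : ℂ)‖ : ℝ) ≤ (N : ℝ) ^ 10 := by
    rw [norm_mul, Complex.norm_natCast]
    have : ‖b‖ * w ≤ N * (N : ℝ) ^ 5 := by gcongr
    have h9 : (0 : ℝ) ≤ (N : ℝ) ^ 9 := by positivity
    calc (x + ‖b‖ * w : ℝ) ≤ (N : ℝ) ^ 9 + N * (N : ℝ) ^ 5 := by linarith
      _ = (N : ℝ) ^ 9 + (N : ℝ) ^ 6 := by ring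
      _ ≤ 338 * (N : ℝ) ^ 9 := by linarith
      _ ≤ N * (N : ℝ) ^ 9 := by gcongr
      _ = _ := by ring
  have e2 : ‖((y : ℂ) + g * (w : ℂ))‖ ≤ (N : ℝ) ^ 7 := by
    have h := norm_add_le (y : ℂ) (g * (w : ℂ))
    rw [norm_mul, Complex.norm_natCast, Complex.norm_natCast] at h
    have : ‖g‖ * w ≤ N * (N : ℝ) ^ 5 := by gcongr
    have h6' : (0 : ℝ) ≤ (N : ℝ) ^ 6 := by positivity
    calc _ ≤ (N : ℝ) ^ 5 + N * (N : ℝ) ^ 5 := by linarith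
      _ = (N : ℝ) ^ 5 + (N : ℝ) ^ 6 := by ring
      _ ≤ 338 * (N : ℝ) ^ 6 := by linarith
      _ ≤ N * (N : ℝ) ^ 6 := by gcongr
      _ = _ := by ring
  rw [norm_mul, norm_pow]
  calc _ ≤ ((x + ‖b * (w : ℂ)‖ : ℝ) ^ m * ((N : ℝ) ^ 17) ^ x) *
        ‖((y : ℂ) + g * (w : ℂ))‖ ^ n := by gcongr
    _ ≤ (((N : ℝ) ^ 10) ^ m * ((N : ℝ) ^ 17) ^ x) * ((N : ℝ) ^ 7) ^ n := by gcongr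
    _ ≤ (((N : ℝ) ^ 10) ^ (N ^ 9) * ((N : ℝ) ^ 17) ^ (N ^ 9)) * ((N : ℝ) ^ 7) ^ (N ^ 9) := by
      gcongr
      · exact one_le_pow₀ hN1
      · exact one_le_pow₀ hN1
      · exact one_le_pow₀ hN1
    _ = _ := by
      simp only [← pow_mul, ← pow_add]
      congr 1
      ring

lemma PQ_bound (N : ℕ) (P Q l j y : ℕ) (hP : 1 ≤ P) (hQ : 1 ≤ Q) (hPQ : P * Q ≤ N)
    (hN : 1 ≤ N) (hl : l ≤ N ^ (3 + j)) (hy : y ≤ N ^ 5) :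
    ((P : ℝ) ^ (y * l) * (Q : ℝ) ^ ((N ^ 5 - y) * l)) ≤ (N : ℝ) ^ N ^ (9 + j) := by
  have : P ^ (y * l) * Q ^ ((N ^ 5 - y) * l) ≤ N ^ N ^ (9 + j) := by
    calc P ^ (y * l) * Q ^ ((N ^ 5 - y) * l) ≤ P ^ (N ^ 5 * l) * Q ^ (N ^ 5 * l) := by
          gcongr
          exact Nat.sub_le _ _
      _ = (P * Q) ^ (N ^ 5 * l) := by rw [mul_pow]
      _ ≤ N ^ (N ^ 5 * l) := by gcongr
      _ ≤ N ^ N ^ (9 + j) := by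
        apply Nat.pow_le_pow_right hN
        calc N ^ 5 * l ≤ N ^ 5 * N ^ (3 + j) := by gcongr
          _ = N ^ (8 + j) := by rw [← pow_add]; congr 1; omega
          _ ≤ _ := Nat.pow_le_pow_right hN (by omega)
  exact_mod_cast this

lemma coef_bound (N : ℕ) (hN : 338 ≤ N) (b g : ℂ) (hb : ‖b‖ ≤ N) (hg : ‖g‖ ≤ N)
    (P Q l j : ℕ) (hP : 1 ≤ P) (hQ : 1 ≤ Q) (hPQ : P * Q ≤ N) (hj : j ≤ 11)
    (hl : l ≤ N ^ (3 + j)) (m n x y w : ℕ) (hm : m ≤ N ^ 9) (hn : n ≤ N ^ 9)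
    (hx : x < N ^ 9) (hy : y < N ^ 5) (hw : w < N ^ 5) :
    ‖coef b g P Q (N ^ 5) m n l x y w‖ ≤ ((N : ℝ) ^ N ^ (9 + j)) ^ 35 := by
  have hN1 : 1 ≤ N := by omega
  unfold coef
  rw [mul_assoc, norm_mul]
  have hlz : ‖(l : ℂ)‖ ≤ (N : ℝ) ^ 17 := by
    rw [Complex.norm_natCast]
    have : l ≤ N ^ 17 := hl.trans (Nat.pow_le_pow_right hN1 (by omega))
    exact_mod_cast this
  have h1 := base_bound N hN b g l hb hg hlz m n x y w hm hn hx hy hw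
  have h2 := PQ_bound N P Q l j y hP hQ hPQ hN1 hl hy.le
  have h3 : ‖(P : ℂ) ^ (y * l) * (Q : ℂ) ^ ((N ^ 5 - y) * l)‖ =
      (P : ℝ) ^ (y * l) * (Q : ℝ) ^ ((N ^ 5 - y) * l) := by simp
  rw [h3]
  have h4 := U_mono N j hN1
  calc _ ≤ ((N : ℝ) ^ N ^ 9) ^ 34 * ((N : ℝ) ^ N ^ (9 + j)) := by gcongr
    _ ≤ ((N : ℝ) ^ N ^ (9 + j)) ^ 34 * ((N : ℝ) ^ N ^ (9 + j)) := by gcongr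
    _ = _ := by ring

lemma pow_le_U (N k : ℕ) (hN : 338 ≤ N) (hk : k ≤ 338) : (N : ℝ) ^ k ≤ (N : ℝ) ^ N ^ 9 := by
  apply pow_le_pow_right₀ (by exact_mod_cast (by omega : 1 ≤ N))
  exact (hk.trans hN).trans (Nat.le_self_pow (by norm_num) N)

lemma Phi_sup (N : ℕ) (hN : 338 ≤ N) (b g ω : ℂ) (hb : ‖b‖ ≤ N) (hg : ‖g‖ ≤ N)
    (hexp : Real.exp (4 * (‖ω‖ + ‖b + g * ω‖)) ≤ N) (j : ℕ) (hj : j ≤ 11)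
    (p : Idx (N ^ 9) (N ^ 5) → ℂ) (hp : ∀ i, ‖p i‖ ≤ ((N : ℝ) ^ N ^ 9) ^ 36)
    (m n : ℕ) (hm : m ≤ N ^ 9) (hn : n ≤ N ^ 9) (z : ℂ) (hz : ‖z‖ ≤ 4 * (N : ℝ) ^ (4 + j)) :
    ‖PhiI b g ω p m n z‖ ≤ ((N : ℝ) ^ N ^ (9 + j)) ^ 72 := by
  have hNr : (338 : ℝ) ≤ N := by exact_mod_cast hN
  have hN1 : (1 : ℝ) ≤ N := by linarith
  have h4 := U_mono N j (by omega)
  have hz17 : ‖z‖ ≤ (N : ℝ) ^ 17 := by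
    calc ‖z‖ ≤ 4 * (N : ℝ) ^ (4 + j) := hz
      _ ≤ N * (N : ℝ) ^ (4 + j) := by gcongr; linarith
      _ = (N : ℝ) ^ (5 + j) := by ring
      _ ≤ _ := pow_le_pow_right₀ hN1 (by omega)
  unfold PhiI Phi
  have hterm : ∀ i : Idx (N ^ 9) (N ^ 5), ‖p i * (qp (b * ((i.2.2 : ℕ) : ℂ)) m (i.1 : ℕ)).eval z *
      (((i.2.1 : ℕ) : ℂ) + g * ((i.2.2 : ℕ) : ℂ)) ^ n *
      Complex.exp ((((i.2.1 : ℕ) : ℂ) * ω + (b + g * ω) * ((i.2.2 : ℕ) : ℂ)) * z)‖ ≤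
      ((N : ℝ) ^ N ^ (9 + j)) ^ 71 := by
    intro i
    have h1 := base_bound N hN b g z hb hg hz17 m n i.1 i.2.1 i.2.2 hm hn i.1.2 i.2.1.2 i.2.2.2
    have h2 : ‖Complex.exp ((((i.2.1 : ℕ) : ℂ) * ω + (b + g * ω) * ((i.2.2 : ℕ) : ℂ)) * z)‖ ≤
        (N : ℝ) ^ N ^ (9 + j) := by
      refine (Complex.norm_exp_le_exp_norm _).trans ?_
      have hy : ((i.2.1 : ℕ) : ℝ) ≤ (N : ℝ) ^ 5 := by exact_mod_cast i.2.1.2.le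
      have hw : ((i.2.2 : ℕ) : ℝ) ≤ (N : ℝ) ^ 5 := by exact_mod_cast i.2.2.2.le
      have h3 : ‖(((i.2.1 : ℕ) : ℂ) * ω + (b + g * ω) * ((i.2.2 : ℕ) : ℂ)) * z‖ ≤
          ((N ^ (9 + j) : ℕ) : ℝ) * (4 * (‖ω‖ + ‖b + g * ω‖)) := by
        rw [norm_mul]
        have h5 : ‖((i.2.1 : ℕ) : ℂ) * ω + (b + g * ω) * ((i.2.2 : ℕ) : ℂ)‖ ≤
            (N : ℝ) ^ 5 * ‖ω‖ + ‖b + g * ω‖ * (N : ℝ) ^ 5 := by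
          refine (norm_add_le _ _).trans ?_
          rw [norm_mul, norm_mul, Complex.norm_natCast, Complex.norm_natCast]
          gcongr
        calc _ ≤ ((N : ℝ) ^ 5 * ‖ω‖ + ‖b + g * ω‖ * (N : ℝ) ^ 5) * (4 * (N : ℝ) ^ (4 + j)) := by
              gcongr
          _ = _ := by push_cast; ring
      calc _ ≤ Real.exp (((N ^ (9 + j) : ℕ) : ℝ) * (4 * (‖ω‖ + ‖b + g * ω‖))) :=
            Real.exp_le_exp.2 h3
        _ = Real.exp (4 * (‖ω‖ + ‖b + g * ω‖)) ^ (N ^ (9 + j)) := by rw [Real.exp_nat_mul]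
        _ ≤ _ := by gcongr
    rw [norm_mul, mul_assoc (p i), norm_mul]
    calc _ ≤ ((N : ℝ) ^ N ^ 9) ^ 36 * ((N : ℝ) ^ N ^ 9) ^ 34 * (N : ℝ) ^ N ^ (9 + j) := by
          gcongr
          exact hp i
      _ ≤ ((N : ℝ) ^ N ^ (9 + j)) ^ 36 * ((N : ℝ) ^ N ^ (9 + j)) ^ 34 * (N : ℝ) ^ N ^ (9 + j) := by
          gcongr
      _ = _ := by ring
  refine (norm_sum_le _ _).trans ?_
  refine (Finset.sum_le_sum fun i _ => hterm i).trans ?_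
  rw [Finset.sum_const, nsmul_eq_mul, Finset.card_univ]
  have hc : ((Fintype.card (Idx (N ^ 9) (N ^ 5)) : ℕ) : ℝ) = (N : ℝ) ^ 19 := by
    simp only [Fintype.card_prod, Fintype.card_fin]; push_cast; ring
  rw [hc]
  have := (pow_le_U N 19 hN (by norm_num)).trans h4
  calc _ ≤ ((N : ℝ) ^ N ^ (9 + j)) * ((N : ℝ) ^ N ^ (9 + j)) ^ 71 := by gcongr
    _ = _ := by ring


open NumberField in
lemma siegel_const (K : Type*) [Field K] [NumberField K] : ∃ c : ℝ, ∀ (p q : ℕ) (_ : 0 < p)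
    (_ : p < q) (α β : Type) [Fintype α] [Fintype β] (a : Matrix α β (𝓞 K)) (_ : a ≠ 0)
    (_ : Fintype.card α = p) (_ : Fintype.card β = q) (A : ℝ)
    (_ : ∀ k l, house ((algebraMap (𝓞 K) K) (a k l)) ≤ A),
    ∃ ξ : β → 𝓞 K, ξ ≠ 0 ∧ a.mulVec ξ = 0 ∧
      ∀ l, house (ξ l : K) ≤ c * ((c * q * A) ^ ((p : ℝ) / (q - p))) := by
  classical
  exact ⟨_, fun p q h0p hpq α β _ _ a ha hα hβ A habs =>
    house.exists_ne_zero_int_vec_house_le K a ha h0p hpq hβ habs hα⟩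

open NumberField in
lemma house_le_of {K : Type*} [Field K] [NumberField K] (x : K) (M : ℝ)
    (h : ∀ σ : K →+* ℂ, ‖σ x‖ ≤ M) : house x ≤ M := by
  have h0 : 0 ≤ M := (norm_nonneg _).trans (h (Classical.arbitrary _))
  unfold house
  rw [pi_norm_le_iff_of_nonneg h0]
  intro σ
  exact h σ

open NumberField in
lemma liouville_bound {K : Type*} [Field K] [NumberField K] (x : 𝓞 K) (hx : x ≠ 0) (σ : K →+* ℂ) :
    1 ≤ ‖σ (x : K)‖ * house (x : K) ^ (Module.finrank ℚ K - 1) := by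
  refine le_trans ?_ (norm_norm_le_norm_mul_house_pow (x : K) σ)
  have h : ((Algebra.norm ℤ x : ℤ) : ℚ) = Algebra.norm ℚ (x : K) := by
    simpa using Algebra.coe_norm_int x
  rw [← h]
  have h0 : Algebra.norm ℤ x ≠ 0 := Algebra.norm_ne_zero_iff.2 hx
  have h1 : (1 : ℤ) ≤ |Algebra.norm ℤ x| := Int.one_le_abs h0
  rw [← Rat.norm_cast_real, Real.norm_eq_abs]
  push_cast
  exact_mod_cast h1

open NumberField in
lemma siegel_step {K : Type*} [Field K] [NumberField K] (b g : 𝓞 K) (P Q : ℕ)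
    (hP : 1 ≤ P) (hQ : 1 ≤ Q) :
    ∃ N0 : ℕ, ∀ N ≥ N0, 338 ≤ N → P * Q ≤ N → (∀ σ : K →+* ℂ, ‖σ (b : K)‖ ≤ N) →
      (∀ σ : K →+* ℂ, ‖σ (g : K)‖ ≤ N) →
      ∃ ξ : Idx (N ^ 9) (N ^ 5) → 𝓞 K, ξ ≠ 0 ∧
        (∀ i, house (ξ i : K) ≤ ((N : ℝ) ^ N ^ 9) ^ 36) ∧
        ∀ l < N ^ 2, ∀ m < 13 * N ^ 8, ∀ n < 13 * N ^ 8,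
          ∑ i : Idx (N ^ 9) (N ^ 5), coef b g P Q (N ^ 5) m n l i.1 i.2.1 i.2.2 * ξ i = 0 := by
  obtain ⟨c, hc⟩ := siegel_const K
  obtain ⟨N0, hN0⟩ := exists_nat_ge |c|
  refine ⟨N0, fun N hNN hN hPQ hb hg => ?_⟩
  have hNr : (338 : ℝ) ≤ N := by exact_mod_cast hN
  have hN1 : (1 : ℝ) ≤ N := by linarith
  have hNpos : 0 < N := by omega
  have h139 : 13 * N ^ 8 ≤ N ^ 9 := by
    calc 13 * N ^ 8 ≤ N * N ^ 8 := by gcongr; omega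
      _ = N ^ 9 := by ring
  let a : Matrix (Fin (N ^ 2) × Fin (13 * N ^ 8) × Fin (13 * N ^ 8)) (Idx (N ^ 9) (N ^ 5)) (𝓞 K) :=
    fun e i => coef b g P Q (N ^ 5) e.2.1 e.2.2 e.1 i.1 i.2.1 i.2.2
  have ha : a ≠ 0 := by
    intro h
    have h1 := congrFun (congrFun h (⟨0, by positivity⟩, ⟨0, by positivity⟩, ⟨0, by positivity⟩))
      (⟨0, by positivity⟩, ⟨0, by positivity⟩, ⟨0, by positivity⟩)
    simp [a, coef, qp] at h1
  have hpq2 : 2 * (N ^ 2 * (13 * N ^ 8 * (13 * N ^ 8))) ≤ N ^ 9 * (N ^ 5 * N ^ 5) := by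
    calc 2 * (N ^ 2 * (13 * N ^ 8 * (13 * N ^ 8))) = 338 * N ^ 18 := by ring
      _ ≤ N * N ^ 18 := by gcongr
      _ = _ := by ring
  have hppos : 0 < N ^ 2 * (13 * N ^ 8 * (13 * N ^ 8)) := by positivity
  obtain ⟨ξ, hξ0, hξ, hξb⟩ := hc (N ^ 2 * (13 * N ^ 8 * (13 * N ^ 8))) (N ^ 9 * (N ^ 5 * N ^ 5))
    hppos (by omega) _ _ a ha (by simp) (by simp) (((N : ℝ) ^ N ^ 9) ^ 35) (by
      intro e i
      apply house_le_of
      intro σ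
      have h1 := coef_map (σ.comp (algebraMap (𝓞 K) K)) b g P Q (N ^ 5) e.2.1 e.2.2 e.1
        i.1 i.2.1 i.2.2
      simp only [RingHom.comp_apply] at h1
      rw [h1]
      exact coef_bound N hN _ _ (hb σ) (hg σ) P Q e.1 0 hP hQ hPQ (by norm_num)
        (e.1.2.le.trans (Nat.pow_le_pow_right hNpos (by norm_num))) _ _ _ _ _
        (e.2.1.2.le.trans h139) (e.2.2.2.le.trans h139) i.1.2 i.2.1.2 i.2.2.2)
  refine ⟨ξ, hξ0, fun i => (hξb i).trans ?_, ?_⟩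
  · set q : ℕ := N ^ 9 * (N ^ 5 * N ^ 5) with hq
    set p : ℕ := N ^ 2 * (13 * N ^ 8 * (13 * N ^ 8)) with hp
    have hpq2' : 2 * (p : ℝ) ≤ q := by exact_mod_cast hpq2
    have hppos' : (0 : ℝ) < p := by exact_mod_cast hppos
    have hcN : |c| ≤ N := hN0.trans (by exact_mod_cast hNN)
    have hU1 : (1 : ℝ) ≤ (N : ℝ) ^ N ^ 9 := one_le_pow₀ hN1
    set U := (N : ℝ) ^ N ^ 9 with hU
    have he : (p : ℝ) / (q - p) ≤ 1 := by
      rw [div_le_one (by linarith)]; linarith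
    have he0 : 0 ≤ (p : ℝ) / (q - p) := div_nonneg hppos'.le (by linarith)
    have hq' : (q : ℝ) = (N : ℝ) ^ 19 := by rw [hq]; push_cast; ring
    have hY : (1 : ℝ) ≤ N * q * U ^ 35 := by
      rw [hq']
      have : (1 : ℝ) ≤ (N : ℝ) ^ 19 := one_le_pow₀ hN1
      have : (1 : ℝ) ≤ U ^ 35 := one_le_pow₀ hU1
      calc (1 : ℝ) = 1 * 1 * 1 := by norm_num
        _ ≤ _ := by gcongr
    calc c * ((c * q * U ^ 35) ^ ((p : ℝ) / (q - p)))
        ≤ |c * ((c * q * U ^ 35) ^ ((p : ℝ) / (q - p)))| := le_abs_self _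
      _ = |c| * |(c * q * U ^ 35) ^ ((p : ℝ) / (q - p))| := abs_mul _ _
      _ ≤ N * (N * q * U ^ 35) := by
        gcongr
        refine (Real.abs_rpow_le_abs_rpow _ _).trans ?_
        rw [abs_mul, abs_mul, abs_of_nonneg (by positivity : (0 : ℝ) ≤ q),
          abs_of_nonneg (by positivity : (0 : ℝ) ≤ U ^ 35)]
        calc (|c| * q * U ^ 35) ^ ((p : ℝ) / (q - p))
            ≤ (N * q * U ^ 35) ^ ((p : ℝ) / (q - p)) := by
              apply Real.rpow_le_rpow (by positivity) _ he0
              gcongr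
          _ ≤ (N * q * U ^ 35) ^ (1 : ℝ) := Real.rpow_le_rpow_of_exponent_le hY he
          _ = _ := Real.rpow_one _
      _ = (N : ℝ) ^ 21 * U ^ 35 := by rw [hq']; ring
      _ ≤ U * U ^ 35 := by
        gcongr
        exact pow_le_U N 21 hN (by norm_num)
      _ = U ^ 36 := by ring
  · intro l hl m hm n hn
    exact congrFun hξ (⟨l, hl⟩, ⟨m, hm⟩, ⟨n, hn⟩)

open NumberField in
lemma extrapolate {K : Type*} [Field K] [NumberField K] (φ : K →+* ℂ) (b g : 𝓞 K) (P Q : ℕ)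
    (hP : 1 ≤ P) (hQ : 1 ≤ Q) (ω : ℂ) (k : ℤ) (hA : Complex.exp ω = (P : ℂ) / Q)
    (hk : φ b + φ g * ω = 2 * Real.pi * Complex.I * k)
    (N : ℕ) (hN : 338 ≤ N) (hPQ : P * Q ≤ N) (hb : ∀ σ : K →+* ℂ, ‖σ (b : K)‖ ≤ N)
    (hg : ∀ σ : K →+* ℂ, ‖σ (g : K)‖ ≤ N)
    (hexp : Real.exp (4 * (‖ω‖ + ‖φ b + φ g * ω‖)) ≤ N)
    (hd : 73 + 72 * Module.finrank ℚ K < N)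
    (ξ : Idx (N ^ 9) (N ^ 5) → 𝓞 K) (hξ : ∀ i, house (ξ i : K) ≤ ((N : ℝ) ^ N ^ 9) ^ 36)
    (j : ℕ) (hj : j ≤ 11)
    (h : ∀ l < N ^ (2 + j), ∀ m < (13 - j) * N ^ 8, ∀ n < (13 - j) * N ^ 8,
      PhiI (φ b) (φ g) ω (fun i => φ (ξ i)) m n l = 0) :
    ∀ l < N ^ (2 + (j + 1)), ∀ m < (13 - (j + 1)) * N ^ 8, ∀ n < (13 - (j + 1)) * N ^ 8,
      PhiI (φ b) (φ g) ω (fun i => φ (ξ i)) m n l = 0 := by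
  intro l hl m hm n hn
  have hNr : (338 : ℝ) ≤ N := by exact_mod_cast hN
  have hN1 : (1 : ℝ) ≤ N := by linarith
  have hNpos : 0 < N := by omega
  have hN0 : (0 : ℝ) < N := by linarith
  have h139 : ∀ m, m < (13 - (j + 1)) * N ^ 8 → m ≤ N ^ 9 := by
    intro m hm
    calc m ≤ (13 - (j + 1)) * N ^ 8 := hm.le
      _ ≤ N * N ^ 8 := by gcongr; omega
      _ = N ^ 9 := by ring
  have hm9 := h139 m hm
  have hn9 := h139 n hn
  have hl' : l ≤ N ^ (3 + j) := hl.le.trans (le_of_eq (by congr 1; omega))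
  have hTj : (13 - (j + 1)) * N ^ 8 + N ^ 8 = (13 - j) * N ^ 8 := by
    rw [show 13 - j = (13 - (j + 1)) + 1 by omega]; ring
  set U := (N : ℝ) ^ N ^ (9 + j) with hU
  have hU1 : (1 : ℝ) < U := by
    apply one_lt_pow₀ (by linarith)
    positivity
  have hU0 : (0 : ℝ) < U := by linarith
  have h4 := U_mono N j (by omega)
  have hpc : ∀ (σ : K →+* ℂ) i, ‖σ (ξ i)‖ ≤ ((N : ℝ) ^ N ^ 9) ^ 36 :=
    fun σ i => (norm_embedding_le_house _ σ).trans (hξ i)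
  -- analytic estimate
  have han : ‖PhiI (φ b) (φ g) ω (fun i => φ (ξ i)) m n l‖ ≤ U ^ 72 * (1 / U) ^ N := by
    have hs := schwarz_many (PhiI (φ b) (φ g) ω (fun i => φ (ξ i)) m n)
      (Phi_diff _ _ _ _ _ _ _ _ _) (N ^ (2 + j)) (N ^ 8) (by
        intro l' hl' k' hk'
        exact Phi_iter _ _ _ _ _ _ _ _ ((13 - j) * N ^ 8) k' m n (by omega) (by omega)
          (fun m hm n hn => h l' hl' m hm n hn))
      ((N : ℝ) ^ (3 + j)) (4 * (N : ℝ) ^ (4 + j)) (U ^ 72) (by positivity)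
      (by push_cast; exact pow_le_pow_right₀ hN1 (by omega))
      (by gcongr; norm_num)
      (fun z hz => Phi_sup N hN _ _ ω (hb φ) (hg φ) hexp j hj _ (hpc φ) m n hm9 hn9 z hz)
      (l : ℂ) (by rw [Complex.norm_natCast]; exact_mod_cast hl')
    refine hs.trans (le_of_eq ?_)
    congr 1
    have e1 : 4 * (N : ℝ) ^ (3 + j) / (4 * (N : ℝ) ^ (4 + j)) = 1 / N := by
      rw [show 4 + j = (3 + j) + 1 by omega, pow_succ]
      field_simp
    rw [e1, one_div, one_div, inv_pow, inv_pow, hU, ← pow_mul]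
    congr 2
    ring
  -- arithmetic estimate
  by_contra hne
  let α : 𝓞 K := ∑ i : Idx (N ^ 9) (N ^ 5), coef b g P Q (N ^ 5) m n l i.1 i.2.1 i.2.2 * ξ i
  have hσ : ∀ σ : K →+* ℂ, σ (α : K) = ∑ i : Idx (N ^ 9) (N ^ 5),
      coef (σ b) (σ g) P Q (N ^ 5) m n l i.1 i.2.1 i.2.2 * σ (ξ i) := by
    intro σ
    have : σ (α : K) = (σ.comp (algebraMap (𝓞 K) K)) α := rfl
    rw [this]
    simp only [α, map_sum, map_mul, coef_map]
    rfl
  have hφ : φ (α : K) = (Q : ℂ) ^ (N ^ 5 * l) *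
      PhiI (φ b) (φ g) ω (fun i => φ (ξ i)) m n l := by
    rw [hσ, ← PhiI_coef (φ b) (φ g) ω P Q (by omega) k hA hk (fun i => φ (ξ i)) m n l]
  have hα0 : α ≠ 0 := by
    intro h0
    rw [h0] at hφ
    have hQ' : (Q : ℂ) ≠ 0 := by exact_mod_cast (by omega : Q ≠ 0)
    have : (Q : ℂ) ^ (N ^ 5 * l) * PhiI (φ b) (φ g) ω (fun i => φ (ξ i)) m n l = 0 := by
      rw [← hφ]; simp
    rcases mul_eq_zero.1 this with h1 | h1
    · exact pow_ne_zero _ hQ' h1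
    · exact hne h1
  have hh : house (α : K) ≤ U ^ 72 := by
    apply house_le_of
    intro σ
    rw [hσ]
    refine (norm_sum_le _ _).trans ?_
    have ht : ∀ i ∈ (Finset.univ : Finset (Idx (N ^ 9) (N ^ 5))),
        ‖coef (σ b) (σ g) P Q (N ^ 5) m n l i.1 i.2.1 i.2.2 * σ (ξ i)‖ ≤ U ^ 71 := by
      intro i _
      rw [norm_mul]
      have h1 := coef_bound N hN _ _ (hb σ) (hg σ) P Q l j hP hQ hPQ hj hl' m n i.1 i.2.1 i.2.2
        hm9 hn9 i.1.2 i.2.1.2 i.2.2.2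
      calc _ ≤ U ^ 35 * ((N : ℝ) ^ N ^ 9) ^ 36 := by
            gcongr
            exact hpc σ i
        _ ≤ U ^ 35 * U ^ 36 := by gcongr
        _ = _ := by ring
    refine (Finset.sum_le_sum ht).trans ?_
    rw [Finset.sum_const, nsmul_eq_mul, Finset.card_univ]
    have hc : ((Fintype.card (Idx (N ^ 9) (N ^ 5)) : ℕ) : ℝ) = (N : ℝ) ^ 19 := by
      simp only [Fintype.card_prod, Fintype.card_fin]; push_cast; ring
    rw [hc]
    have := (pow_le_U N 19 hN (by norm_num)).trans h4
    calc _ ≤ U * U ^ 71 := by gcongr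
      _ = _ := by ring
  have hQb : ‖(Q : ℂ) ^ (N ^ 5 * l)‖ ≤ U := by
    have := PQ_bound N P Q l j 0 hP hQ hPQ (by omega) hl' (by positivity)
    simpa using this
  have hL := liouville_bound α hα0 φ
  have hfin : (1 : ℝ) ≤ U ^ (73 + 72 * Module.finrank ℚ K) * (1 / U) ^ N := by
    refine hL.trans ?_
    rw [hφ, norm_mul]
    calc _ ≤ (U * (U ^ 72 * (1 / U) ^ N)) * (U ^ 72) ^ (Module.finrank ℚ K) := by
          have h1 : house (α : K) ^ (Module.finrank ℚ K - 1) ≤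
              (U ^ 72) ^ (Module.finrank ℚ K) := by
            calc _ ≤ (U ^ 72) ^ (Module.finrank ℚ K - 1) := by
                  gcongr
                  exact house_nonneg _
              _ ≤ _ := pow_le_pow_right₀ (one_le_pow₀ hU1.le) (Nat.sub_le _ _)
          have h0 := house_nonneg (α : K)
          gcongr
      _ = _ := by rw [← pow_mul, pow_add]; ring
  rw [one_div, inv_pow, ← div_eq_mul_inv, le_div_iff₀ (by positivity), one_mul] at hfin
  have := (pow_le_pow_iff_right₀ hU1).1 hfin
  omega

open NumberField in
theorem baker_core {K : Type*} [Field K] [NumberField K] (φ : K →+* ℂ) (b g : 𝓞 K) (P Q : ℕ)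
    (hP : 1 ≤ P) (hQ : 1 ≤ Q) (hne : P ≠ Q) (ω : ℂ) (k : ℤ) (hA : Complex.exp ω = (P : ℂ) / Q)
    (hk : φ b + φ g * ω = 2 * Real.pi * Complex.I * k) (hbg : b ≠ 0 ∨ g ≠ 0) : False := by
  obtain ⟨N0, hN0⟩ := siegel_step b g P Q hP hQ
  obtain ⟨N1, hN1⟩ := exists_nat_ge (house (b : K))
  obtain ⟨N2, hN2⟩ := exists_nat_ge (house (g : K))
  obtain ⟨N3, hN3⟩ := exists_nat_ge (Real.exp (4 * (‖ω‖ + ‖φ b + φ g * ω‖)))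
  obtain ⟨N, hN⟩ : ∃ N : ℕ, N = N0 + N1 + N2 + N3 + P * Q + 338 + (74 + 72 * Module.finrank ℚ K) :=
    ⟨_, rfl⟩
  have hb : ∀ σ : K →+* ℂ, ‖σ (b : K)‖ ≤ N := fun σ =>
    ((norm_embedding_le_house _ σ).trans hN1).trans (by exact_mod_cast (by omega : N1 ≤ N))
  have hg : ∀ σ : K →+* ℂ, ‖σ (g : K)‖ ≤ N := fun σ =>
    ((norm_embedding_le_house _ σ).trans hN2).trans (by exact_mod_cast (by omega : N2 ≤ N))
  have hexp : Real.exp (4 * (‖ω‖ + ‖φ b + φ g * ω‖)) ≤ N :=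
    hN3.trans (by exact_mod_cast (by omega : N3 ≤ N))
  obtain ⟨ξ, hξ0, hξ, hv⟩ := hN0 N (by omega) (by omega) (by omega) hb hg
  have hall : ∀ j ≤ 12, ∀ l < N ^ (2 + j), ∀ m < (13 - j) * N ^ 8, ∀ n < (13 - j) * N ^ 8,
      PhiI (φ b) (φ g) ω (fun i => φ (ξ i)) m n l = 0 := by
    intro j
    induction j with
    | zero =>
      intro _ l hl m hm n hn
      have h1 := congrArg (fun x : 𝓞 K => (φ.comp (algebraMap (𝓞 K) K)) x) (hv l hl m hm n hn)
      simp only [map_sum, map_mul, coef_map, map_zero] at h1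
      have h2 := PhiI_coef (φ b) (φ g) ω P Q (by omega) k hA hk (fun i => φ (ξ i)) m n l
      have hQ' : (Q : ℂ) ≠ 0 := by exact_mod_cast (by omega : Q ≠ 0)
      have h3 : (Q : ℂ) ^ (N ^ 5 * l) * PhiI (φ b) (φ g) ω (fun i => φ (ξ i)) m n l = 0 := by
        rw [← h2]; exact h1
      exact (mul_eq_zero.1 h3).resolve_left (pow_ne_zero _ hQ')
    | succ j ih =>
      intro hj
      exact extrapolate φ b g P Q hP hQ ω k hA hk N (by omega) (by omega) hb hg hexp (by omega)
        ξ hξ j (by omega) (ih (by omega))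
  have h12 := hall 12 le_rfl
  have hNpos : 0 < N := by omega
  have h58 : N ^ 5 ≤ (13 - 12) * N ^ 8 := by
    rw [show 13 - 12 = 1 by norm_num, one_mul]
    exact Nat.pow_le_pow_right hNpos (by norm_num)
  have hinj : Function.Injective φ := φ.injective
  have hP' : (0 : ℝ) < P := by exact_mod_cast hP
  have hQ' : (0 : ℝ) < Q := by exact_mod_cast hQ
  have hz := final_zero (L0 := N ^ 9) (L := N ^ 5) (by positivity) (φ b) (φ g) ω ((P : ℝ) / Q)
    (by positivity) (by
      intro h
      rw [div_eq_one_iff_eq hQ'.ne'] at h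
      exact hne (by exact_mod_cast h)) k (by rw [hA]; push_cast; rfl) hk
    (by
      rcases hbg with h | h
      · left; simpa using h
      · right; simpa using h) (fun i => φ (ξ i))
    (fun l hl m hm n hn => h12 l (by rw [← pow_add] at hl; exact hl) m (by omega) n (by omega))
  apply hξ0
  funext i
  have := congrFun hz i
  simpa using this


open NumberField in
/-- Complex version of `baker_core`. -/
theorem baker_complex (b g ω : ℂ) (hb : IsIntegral ℤ b) (hg : IsIntegral ℤ g) (P Q : ℕ)
    (hP : 1 ≤ P) (hQ : 1 ≤ Q) (hne : P ≠ Q) (k : ℤ) (hA : Complex.exp ω = (P : ℂ) / Q)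
    (hk : b + g * ω = 2 * Real.pi * Complex.I * k) (hbg : b ≠ 0 ∨ g ≠ 0) : False := by
  have hfd : FiniteDimensional ℚ (IntermediateField.adjoin ℚ ({b, g} : Set ℂ)) := by
    apply IntermediateField.finiteDimensional_adjoin
    intro x hx
    rcases hx with rfl | hx
    · exact hb.tower_top
    · rw [Set.mem_singleton_iff] at hx
      subst hx
      exact hg.tower_top
  have hnf : NumberField (IntermediateField.adjoin ℚ ({b, g} : Set ℂ)) := ⟨⟩
  have hbm : b ∈ IntermediateField.adjoin ℚ ({b, g} : Set ℂ) :=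
    IntermediateField.subset_adjoin _ _ (by simp)
  have hgm : g ∈ IntermediateField.adjoin ℚ ({b, g} : Set ℂ) :=
    IntermediateField.subset_adjoin _ _ (by simp)
  have hinj : Function.Injective
      (algebraMap (IntermediateField.adjoin ℚ ({b, g} : Set ℂ)) ℂ) := RingHom.injective _
  have hb' : IsIntegral ℤ (⟨b, hbm⟩ : IntermediateField.adjoin ℚ ({b, g} : Set ℂ)) :=
    (isIntegral_algebraMap_iff hinj).1 hb
  have hg' : IsIntegral ℤ (⟨g, hgm⟩ : IntermediateField.adjoin ℚ ({b, g} : Set ℂ)) :=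
    (isIntegral_algebraMap_iff hinj).1 hg
  refine baker_core (algebraMap (IntermediateField.adjoin ℚ ({b, g} : Set ℂ)) ℂ)
    ⟨_, hb'⟩ ⟨_, hg'⟩ P Q hP hQ hne ω k hA hk ?_
  rcases hbg with h | h
  · left
    intro h0
    apply h
    have := congrArg (fun x : 𝓞 (IntermediateField.adjoin ℚ ({b, g} : Set ℂ)) =>
      ((x : IntermediateField.adjoin ℚ ({b, g} : Set ℂ)) : ℂ)) h0
    exact this.trans (by simp)
  · right
    intro h0
    apply h
    have := congrArg (fun x : 𝓞 (IntermediateField.adjoin ℚ ({b, g} : Set ℂ)) =>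
      ((x : IntermediateField.adjoin ℚ ({b, g} : Set ℂ)) : ℂ)) h0
    exact this.trans (by simp)

/-- `log (P/Q) + (π/2) k` is zero or transcendental. -/
theorem log_add_pi_zero_or_transcendental (P Q : ℕ) (hP : 1 ≤ P) (hQ : 1 ≤ Q) (k : ℤ) (β : ℝ)
    (hβ : β = Real.log ((P : ℝ) / Q) + Real.pi / 2 * k) : β = 0 ∨ Transcendental ℚ β := by
  by_contra! hcon
  obtain ⟨h0, ht⟩ := hcon
  have halg : IsAlgebraic ℚ β := by
    by_contra h
    exact ht h
  have halgZ : IsAlgebraic ℤ β := (IsFractionRing.isAlgebraic_iff ℤ ℚ ℝ).2 halg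
  obtain ⟨D, hD, hDint⟩ := halgZ.exists_integral_multiple
  have hDintC : IsIntegral ℤ (((D • β : ℝ)) : ℂ) :=
    hDint.map (Complex.ofRealHom.toIntAlgHom)
  have hI : IsIntegral ℤ Complex.I := by
    refine ⟨Polynomial.X ^ 2 + 1, by monicity!, by simp⟩
  have h4 : ∀ z : ℤ, IsIntegral ℤ (z : ℂ) := fun z => by
    simpa using (isIntegral_algebraMap (R := ℤ) (A := ℂ) (x := z))
  have hb : IsIntegral ℤ (((4 : ℤ) : ℂ) * Complex.I * ((D • β : ℝ) : ℂ)) :=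
    ((h4 4).mul hI).mul hDintC
  have hDC : (D : ℂ) ≠ 0 := by exact_mod_cast hD
  by_cases hPQ : P = Q
  · subst hPQ
    have hP0 : (P : ℝ) ≠ 0 := by exact_mod_cast (by omega : P ≠ 0)
    rw [div_self hP0, Real.log_one, zero_add] at hβ
    refine baker_complex _ 0 (Real.log 2 : ℝ) hb isIntegral_zero 2 1 (by norm_num) (by norm_num)
      (by norm_num) (k * D) ?_ ?_ ?_
    · rw [← Complex.ofReal_exp, Real.exp_log (by norm_num)]; simp
    · rw [hβ]; simp; ring
    · left
      have : (β : ℂ) ≠ 0 := by exact_mod_cast h0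
      simp [hD, this]
  · have hP' : (0 : ℝ) < P := by exact_mod_cast hP
    have hQ' : (0 : ℝ) < Q := by exact_mod_cast hQ
    have hg : IsIntegral ℤ (-(((4 : ℤ) : ℂ) * Complex.I * (D : ℂ))) :=
      (((h4 4).mul hI).mul (h4 D)).neg
    refine baker_complex _ _ (Real.log ((P : ℝ) / Q) : ℝ) hb hg P Q hP hQ hPQ (k * D) ?_ ?_ ?_
    · rw [← Complex.ofReal_exp, Real.exp_log (by positivity)]; simp
    · rw [hβ]
      simp only [zsmul_eq_mul]
      push_cast
      ring
    · right
      simp [hD]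

end BakerAux

/-- **Key step of Theorem 6.** For number fields `K`, `L` of degrees `n`, `m`, the real
number `m·log|d_K| − n·log|d_L| + (π/2)(n·r₁(L) − m·r₁(K))` is either zero or
transcendental. -/
theorem log_discr_combination_zero_or_transcendental
    (K L : Type*) [Field K] [NumberField K] [Field L] [NumberField L] :
    (Module.finrank ℚ L : ℝ) * Real.log |(NumberField.discr K : ℝ)| -
        (Module.finrank ℚ K : ℝ) * Real.log |(NumberField.discr L : ℝ)| +
      Real.pi / 2 *
        ((Module.finrank ℚ K : ℝ) * (NumberField.InfinitePlace.nrRealPlaces L : ℝ) -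
          (Module.finrank ℚ L : ℝ) * (NumberField.InfinitePlace.nrRealPlaces K : ℝ)) = 0 ∨
    Transcendental ℚ
      ((Module.finrank ℚ L : ℝ) * Real.log |(NumberField.discr K : ℝ)| -
          (Module.finrank ℚ K : ℝ) * Real.log |(NumberField.discr L : ℝ)| +
        Real.pi / 2 *
          ((Module.finrank ℚ K : ℝ) * (NumberField.InfinitePlace.nrRealPlaces L : ℝ) -
            (Module.finrank ℚ L : ℝ) * (NumberField.InfinitePlace.nrRealPlaces K : ℝ))) := by
  have hK : (NumberField.discr K) ≠ 0 := NumberField.discr_ne_zero K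
  have hL : (NumberField.discr L) ≠ 0 := NumberField.discr_ne_zero L
  have hK' : 1 ≤ (NumberField.discr K).natAbs := Nat.one_le_iff_ne_zero.2 (Int.natAbs_ne_zero.2 hK)
  have hL' : 1 ≤ (NumberField.discr L).natAbs := Nat.one_le_iff_ne_zero.2 (Int.natAbs_ne_zero.2 hL)
  refine log_add_pi_zero_or_transcendental
    ((NumberField.discr K).natAbs ^ Module.finrank ℚ L)
    ((NumberField.discr L).natAbs ^ Module.finrank ℚ K)
    (Nat.one_le_pow _ _ hK') (Nat.one_le_pow _ _ hL')
    ((Module.finrank ℚ K : ℤ) * (NumberField.InfinitePlace.nrRealPlaces L : ℤ) -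
      (Module.finrank ℚ L : ℤ) * (NumberField.InfinitePlace.nrRealPlaces K : ℤ)) _ ?_
  have h1 : ((NumberField.discr K).natAbs : ℝ) ≠ 0 := by
    exact_mod_cast (Nat.one_le_iff_ne_zero.1 hK')
  have h2 : ((NumberField.discr L).natAbs : ℝ) ≠ 0 := by
    exact_mod_cast (Nat.one_le_iff_ne_zero.1 hL')
  have h3 : ∀ z : ℤ, |(z : ℝ)| = (z.natAbs : ℝ) := fun z => by
    rw [Nat.cast_natAbs, Int.cast_abs]
  rw [h3, h3, Nat.cast_pow, Nat.cast_pow, Real.log_div (pow_ne_zero _ h1) (pow_ne_zero _ h2),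
    Real.log_pow, Real.log_pow]
  push_cast
  ring
end

section
/- Let K and L be number fields of degrees n and m respectively, and set x_K := (1/2)(r₁(K)·π/2 + n·(log(8π)+γ) − log|d_K|) and x_L := (1/2)(r₁(L)·π/2 + m·(log(8π)+γ) − log|d_L|) (these equal ζ_K'(1/2)/ζ_K(1/2) and ζ_L'(1/2)/ζ_L(1/2) respectively whenever ζ_K(1/2)ζ_L(1/2) ≠ 0). If m·x_K ≠ n·x_L, then at least one of the two real numbers x_K and x_L is transcendental. -/
namespace BakerAux
open Polynomial NumberField

section pieces

theorem degree_C_mul_le' {R : Type*} [CommRing R] (a : R) (p : R[X]) :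
    (C a * p).degree ≤ p.degree := by
  rw [← smul_eq_C_mul]; exact degree_smul_le a p

theorem siegel (K : Type*) [Field K] [NumberField K] :
    ∃ c : ℝ, 1 ≤ c ∧ ∀ (α β : Type) [Fintype α] [Fintype β] (a : Matrix α β (𝓞 K)) (A : ℝ),
      1 ≤ A → (∀ i j, house ((a i j : 𝓞 K) : K) ≤ A) → 0 < Fintype.card α →
      2 * Fintype.card α ≤ Fintype.card β →
      ∃ ξ : β → 𝓞 K, ξ ≠ 0 ∧ a.mulVec ξ = 0 ∧
        ∀ j, house ((ξ j : 𝓞 K) : K) ≤ c * (c * Fintype.card β * A) := by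
  classical
  have key : ∃ c : ℝ, ∀ (α β : Type) [Fintype α] [Fintype β] (a : Matrix α β (𝓞 K)) (A : ℝ),
      a ≠ 0 → (∀ i j, house ((a i j : 𝓞 K) : K) ≤ A) → 0 < Fintype.card α →
      Fintype.card α < Fintype.card β →
      ∃ ξ : β → 𝓞 K, ξ ≠ 0 ∧ a.mulVec ξ = 0 ∧
        ∀ j, house ((ξ j : 𝓞 K) : K) ≤ c * (c * Fintype.card β * A) ^
          ((Fintype.card α : ℝ) / (Fintype.card β - Fintype.card α)) :=
    ⟨_, fun α β _ _ a A ha habs h0 hlt =>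
      house.exists_ne_zero_int_vec_house_le K a ha h0 hlt rfl habs rfl⟩
  obtain ⟨c, hc⟩ := key
  refine ⟨max |c| 1, le_max_right _ _, fun α β _ _ a A hA habs h0 hle => ?_⟩
  have hb : 1 ≤ (Fintype.card β : ℝ) := by
    have : 1 ≤ Fintype.card β := by omega
    exact_mod_cast this
  have hm : (1:ℝ) ≤ max |c| 1 := le_max_right _ _
  have hX : (1:ℝ) ≤ max |c| 1 * Fintype.card β * A :=
    one_le_mul_of_one_le_of_one_le (one_le_mul_of_one_le_of_one_le hm hb) hA
  by_cases ha : a = 0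
  · subst ha
    refine ⟨fun _ => 1, ?_, by simp, fun j => ?_⟩
    · have : 0 < Fintype.card β := by omega
      obtain ⟨b⟩ := Fintype.card_pos_iff.1 this
      intro h
      exact one_ne_zero (congrFun h b)
    · have : house (((1 : 𝓞 K) : 𝓞 K) : K) = 1 := by
        have := house_intCast (K := K) 1
        simpa using this
      rw [this]
      exact one_le_mul_of_one_le_of_one_le hm hX
  · obtain ⟨ξ, h1, h2, h3⟩ := hc α β a A ha habs h0 (by omega)
    refine ⟨ξ, h1, h2, fun j => (h3 j).trans ?_⟩
    have hαβ : (2:ℝ) * Fintype.card α ≤ Fintype.card β := by exact_mod_cast hle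
    have hα : (0:ℝ) < Fintype.card α := by exact_mod_cast h0
    have hexp : ((Fintype.card α : ℝ) / (Fintype.card β - Fintype.card α)) ≤ 1 := by
      rw [div_le_one (by linarith)]; linarith
    have hexp0 : 0 ≤ ((Fintype.card α : ℝ) / (Fintype.card β - Fintype.card α)) :=
      div_nonneg hα.le (by linarith)
    set e := ((Fintype.card α : ℝ) / (Fintype.card β - Fintype.card α))
    have e1 : (c * Fintype.card β * A) ^ e ≤ max |c| 1 * Fintype.card β * A := by
      calc (c * Fintype.card β * A) ^ e ≤ |(c * Fintype.card β * A) ^ e| := le_abs_self _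
        _ ≤ |c * Fintype.card β * A| ^ e := Real.abs_rpow_le_abs_rpow _ _
        _ ≤ (max |c| 1 * Fintype.card β * A) ^ e := by
          apply Real.rpow_le_rpow (abs_nonneg _) _ hexp0
          rw [abs_mul, abs_mul, abs_of_nonneg (by linarith : (0:ℝ) ≤ A),
            abs_of_nonneg (by linarith : (0:ℝ) ≤ (Fintype.card β : ℝ))]
          gcongr
          exact le_max_left _ _
        _ ≤ (max |c| 1 * Fintype.card β * A) ^ (1:ℝ) :=
          Real.rpow_le_rpow_of_exponent_le hX hexp
        _ = _ := Real.rpow_one _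
    have h0 : 0 ≤ |(c * Fintype.card β * A) ^ e| := abs_nonneg _
    calc c * (c * Fintype.card β * A) ^ e ≤ |c * (c * Fintype.card β * A) ^ e| := le_abs_self _
      _ = |c| * |(c * Fintype.card β * A) ^ e| := abs_mul _ _
      _ ≤ max |c| 1 * (max |c| 1 * Fintype.card β * A) := by
        apply mul_le_mul (le_max_left _ _) _ h0 (by linarith)
        calc _ ≤ |c * Fintype.card β * A| ^ e := Real.abs_rpow_le_abs_rpow _ _
          _ ≤ (max |c| 1 * Fintype.card β * A) ^ e := by
            apply Real.rpow_le_rpow (abs_nonneg _) _ hexp0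
            rw [abs_mul, abs_mul, abs_of_nonneg (by linarith : (0:ℝ) ≤ A),
              abs_of_nonneg (by linarith : (0:ℝ) ≤ (Fintype.card β : ℝ))]
            gcongr
            exact le_max_left _ _
          _ ≤ (max |c| 1 * Fintype.card β * A) ^ (1:ℝ) :=
            Real.rpow_le_rpow_of_exponent_le hX hexp
          _ = _ := Real.rpow_one _

theorem liouville {K : Type*} [Field K] [NumberField K] (φ : K →+* ℂ) (x : 𝓞 K) (hx : x ≠ 0)
    (H : ℝ) (hH : house (x : K) ≤ H) :
    1 ≤ ‖φ (x : K)‖ * H ^ (Module.finrank ℚ K - 1) := by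
  have h1 := norm_norm_le_norm_mul_house_pow (x : K) φ
  have h2 : (1:ℝ) ≤ ‖Algebra.norm ℚ (x : K)‖ := by
    have h3 : Algebra.norm ℤ x ≠ 0 := Algebra.norm_ne_zero_iff.mpr hx
    have h4 : Algebra.norm ℚ (x : K) = ((Algebra.norm ℤ x : ℤ) : ℚ) :=
      (Algebra.coe_norm_int x).symm
    rw [h4]
    have : (1:ℤ) ≤ |Algebra.norm ℤ x| := Int.one_le_abs h3
    have h5 : ‖((Algebra.norm ℤ x : ℤ) : ℚ)‖ = ((|Algebra.norm ℤ x| : ℤ) : ℝ) := by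
      rw [← Rat.norm_cast_real]
      simp
    rw [h5]
    exact_mod_cast this
  refine h2.trans (h1.trans ?_)
  have := house_nonneg (x : K)
  gcongr

/-- `(D d/dX + w)^m X^k` evaluated at `x`. -/
def ee {R : Type*} [CommRing R] (D w : R) : ℕ → ℕ → R → R
  | 0, k, x => x ^ k
  | m + 1, k, x => D * k * ee D w m (k - 1) x + w * ee D w m k x

theorem ee_map {R S : Type*} [CommRing R] [CommRing S] (f : R →+* S) (D w : R) (m k : ℕ) (x : R) :
    f (ee D w m k x) = ee (f D) (f w) m k (f x) := by
  induction m generalizing k with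
  | zero => simp [ee]
  | succ m ih => simp [ee, ih]

theorem ee_bound (D w x : ℂ) (X : ℝ) (hX : 1 ≤ X) (hx : ‖x‖ ≤ X) (m k : ℕ) :
    ‖ee D w m k x‖ ≤ (‖D‖ * k + ‖w‖) ^ m * X ^ k := by
  induction m generalizing k with
  | zero => simp only [ee, norm_pow, pow_zero, one_mul]; gcongr
  | succ m ih =>
    have h1 : ‖ee D w m (k - 1) x‖ ≤ (‖D‖ * k + ‖w‖) ^ m * X ^ k := by
      refine (ih (k - 1)).trans ?_
      have : ((k - 1 : ℕ) : ℝ) ≤ k := by exact_mod_cast Nat.sub_le k 1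
      have h2 : X ^ (k - 1) ≤ X ^ k := pow_le_pow_right₀ hX (Nat.sub_le k 1)
      gcongr
    calc ‖ee D w (m + 1) k x‖ ≤ ‖D * k * ee D w m (k - 1) x‖ + ‖w * ee D w m k x‖ := norm_add_le _ _
      _ = ‖D‖ * k * ‖ee D w m (k - 1) x‖ + ‖w‖ * ‖ee D w m k x‖ := by simp
      _ ≤ ‖D‖ * k * ((‖D‖ * k + ‖w‖) ^ m * X ^ k) + ‖w‖ * ((‖D‖ * k + ‖w‖) ^ m * X ^ k) := by
        gcongr
        exact ih k
      _ = _ := by ring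

theorem ee_deriv (D w z : ℂ) (m k : ℕ) :
    HasDerivAt (fun z => ee D w m k z) (k * ee D w m (k - 1) z) z := by
  induction m generalizing k with
  | zero => simpa [ee] using hasDerivAt_pow k z
  | succ m ih =>
    simp only [ee]
    refine (((ih (k - 1)).const_mul (D * k)).fun_add ((ih k).const_mul w)).congr_deriv ?_
    ring

theorem ee_poly {R : Type*} [CommRing R] (D w : R) (m k : ℕ) :
    ee (C D) (C w) m k (X : R[X]) =
      ((D • (derivative : Module.End R R[X]) + w • (1 : Module.End R R[X])) ^ m) (X ^ k) := by
  induction m generalizing k with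
  | zero => simp [ee]
  | succ m ih =>
    rw [ee, ih, ih, pow_succ, Module.End.mul_apply]
    have : (D • (derivative : Module.End R R[X]) + w • (1 : Module.End R R[X])) (X ^ k) =
        (D * k) • X ^ (k - 1) + w • X ^ k := by
      simp [derivative_X_pow, smul_eq_C_mul]
      ring
    rw [this, map_add, map_smul, map_smul, smul_eq_C_mul, smul_eq_C_mul]
    simp

theorem ee_natDegree {R : Type*} [CommRing R] (D w : R) (m k : ℕ) :
    (ee (C D) (C w) m k (X : R[X])).degree ≤ k := by
  induction m generalizing k with
  | zero => simpa [ee] using degree_X_pow_le k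
  | succ m ih =>
    rw [ee]
    have hD : (C D * (k : R[X])) = C (D * k) := by simp
    rw [hD]
    refine (degree_add_le _ _).trans (max_le ?_ ?_)
    · refine (degree_C_mul_le' _ _).trans ((ih _).trans ?_)
      exact_mod_cast Nat.sub_le k 1
    · exact (degree_C_mul_le' _ _).trans (ih _)

theorem separate {R V : Type*} [CommRing R] [IsDomain R] [AddCommGroup V] [Module R V]
    [Module.IsTorsionFree R V] (T : Module.End R V) (n : ℕ) : ∀ (W : Finset R) (P : R → V), W.card ≤ n →
    (∀ m < n, ∑ w ∈ W, ((T + w • (1 : Module.End R V)) ^ m) (P w) = 0) → ∀ w ∈ W, P w = 0 := by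
  classical
  induction n with
  | zero =>
    intro W P hc _ w hw
    simp at hc
    simp [hc] at hw
  | succ n ih =>
    intro W P hc h w1 hw1
    have key : ∀ w ∈ W.erase w1, P w = 0 := by
      have := ih (W.erase w1) (fun w => (w - w1) • P w)
        (by rw [Finset.card_erase_of_mem hw1]; omega) (by
          intro m hm
          have e1 := h (m + 1) (by omega)
          have e2 := congrArg (T + w1 • (1 : Module.End R V)) (h m (by omega))
          rw [map_sum, map_zero] at e2
          have e3 : ∑ w ∈ W, ((T + w • (1 : Module.End R V)) ^ m) ((w - w1) • P w) = 0 := by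
            rw [← sub_zero (0 : V)]
            nth_rw 1 [← e1]
            rw [← e2, ← Finset.sum_sub_distrib]
            refine Finset.sum_congr rfl fun w _ => ?_
            rw [pow_succ', Module.End.mul_apply, map_smul]
            simp only [LinearMap.add_apply, LinearMap.smul_apply, Module.End.one_apply, sub_smul]
            abel
          rw [← Finset.sum_erase_add _ _ hw1] at e3
          simpa using e3)
      intro w hw
      have h1 := this w hw
      exact (smul_eq_zero.mp h1).resolve_left (sub_ne_zero.mpr (Finset.ne_of_mem_erase hw))
    have h0 := h 0 (by omega)
    rw [← Finset.sum_erase_add _ _ hw1, Finset.sum_eq_zero] at h0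
    · simpa using h0
    · intro w hw
      rw [key w hw, map_zero]

theorem zero_lemma {R : Type*} [CommRing R] [IsDomain R] [CharZero R] (N : ℕ) :
    ∀ (T : Finset R) (Q : R → R[X]) (n : R → ℕ), (0 : R) ∉ T →
    (∀ τ ∈ T, (Q τ).degree < n τ) → ∑ τ ∈ T, n τ ≤ N →
    (∀ j < N, ∑ τ ∈ T, (Q τ).eval (j : R) * τ ^ j = 0) → ∀ τ ∈ T, Q τ = 0 := by
  classical
  induction N with
  | zero =>
    intro T Q n _ hd hs _ τ hτ
    have : n τ = 0 := by
      have := Finset.single_le_sum (f := n) (fun _ _ => Nat.zero_le _) hτ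
      omega
    have h := hd τ hτ
    rw [this] at h
    by_contra hne
    have := zero_le_degree_iff.mpr hne
    exact absurd h (not_lt.mpr (by simpa using this))
  | succ N ih =>
    intro T Q n h0 hd hs hz
    by_cases hall : ∀ τ ∈ T, n τ = 0
    · intro τ hτ
      have h := hd τ hτ
      rw [hall τ hτ] at h
      by_contra hne
      have := zero_le_degree_iff.mpr hne
      exact absurd h (not_lt.mpr (by simpa using this))
    push Not at hall
    obtain ⟨σ, hσ, hnσ⟩ := hall
    have hσ0 : σ ≠ 0 := fun h => h0 (h ▸ hσ)
    have key := ih T (fun τ => C τ * taylor 1 (Q τ) - C σ * Q τ)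
      (Function.update n σ (n σ - 1)) h0 (by
        intro τ hτ
        by_cases hτσ : τ = σ
        · subst hτσ
          rw [Function.update_self, ← mul_sub]
          refine (degree_C_mul_le' _ _).trans_lt ?_
          by_cases hQ : Q τ = 0
          · rw [hQ]; simp
          have hlt : (taylor 1 (Q τ) - Q τ).degree < (taylor 1 (Q τ)).degree := by
            apply degree_sub_lt_left
            · simp
            · simpa using hQ
            · simp
          rw [degree_taylor] at hlt
          refine hlt.trans_le ?_
          have h := hd τ hτ
          rw [degree_eq_natDegree hQ] at h ⊢
          have : (Q τ).natDegree < n τ := by exact_mod_cast h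
          have : (Q τ).natDegree ≤ n τ - 1 := by omega
          exact_mod_cast this
        · rw [Function.update_of_ne hτσ]
          refine (degree_sub_le _ _).trans_lt (max_lt ?_ ?_)
          · refine (degree_C_mul_le' _ _).trans_lt ?_
            rw [degree_taylor]; exact hd τ hτ
          · exact (degree_C_mul_le' _ _).trans_lt (hd τ hτ))
      (by
        rw [Finset.sum_update_of_mem hσ]
        rw [← Finset.add_sum_erase _ _ hσ, Finset.erase_eq] at hs
        omega)
      (by
        intro j hj
        have e1 := hz (j + 1) (by omega)
        have e2 := hz j (by omega)
        have : ∑ τ ∈ T, (C τ * taylor 1 (Q τ) - C σ * Q τ).eval (j : R) * τ ^ j =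
            ∑ τ ∈ T, (Q τ).eval ((j + 1 : ℕ) : R) * τ ^ (j + 1) -
            σ * ∑ τ ∈ T, (Q τ).eval (j : R) * τ ^ j := by
          rw [Finset.mul_sum, ← Finset.sum_sub_distrib]
          refine Finset.sum_congr rfl fun τ _ => ?_
          rw [eval_sub, eval_mul, eval_mul, eval_C, eval_C, taylor_eval]
          push_cast
          ring_nf
        rw [this, e1, e2]; simp)
    have hoth : ∀ τ ∈ T, τ ≠ σ → Q τ = 0 := by
      intro τ hτ hne
      have h := sub_eq_zero.mp (key τ hτ)
      have h' := congrArg leadingCoeff h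
      simp only [leadingCoeff_mul, leadingCoeff_C, leadingCoeff_taylor] at h'
      have h'' : (τ - σ) * (Q τ).leadingCoeff = 0 := by rw [sub_mul, h', sub_self]
      rcases mul_eq_zero.mp h'' with h3 | h3
      · exact absurd (sub_eq_zero.mp h3) hne
      · exact leadingCoeff_eq_zero.mp h3
    intro τ hτ
    by_cases hτσ : τ = σ
    swap
    · exact hoth τ hτ hτσ
    subst hτσ
    have h := key τ hτ
    simp only [← mul_sub] at h
    have h1 : taylor 1 (Q τ) = Q τ :=
      sub_eq_zero.mp ((mul_eq_zero.mp h).resolve_left (by simpa using hσ0))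
    have hz0 := hz 0 (by omega)
    rw [← Finset.add_sum_erase _ _ hτ, Finset.sum_eq_zero (s := T.erase τ)] at hz0
    swap
    · intro x hx
      rw [hoth x (Finset.mem_of_mem_erase hx) (Finset.ne_of_mem_erase hx)]; simp
    simp only [Nat.cast_zero, pow_zero, mul_one, add_zero] at hz0
    have hev : ∀ j : ℕ, (Q τ).eval (j : R) = 0 := by
      intro j
      induction j with
      | zero => simpa using hz0
      | succ j ihj =>
        have := congrArg (eval (j : R)) h1
        rw [taylor_eval] at this
        push_cast
        rw [← ihj, ← this, add_comm]
    apply Polynomial.eq_zero_of_infinite_isRoot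
    refine Set.Infinite.mono (s := Set.range (fun j : ℕ => (j : R))) ?_ ?_
    · rintro _ ⟨j, rfl⟩
      exact hev j
    · exact Set.infinite_range_of_injective Nat.cast_injective

theorem factor_one (n : ℕ) : ∀ (F : ℂ → ℂ), Differentiable ℂ F → ∀ a : ℂ,
    (n : ℕ∞) ≤ analyticOrderAt F a →
    ∃ G : ℂ → ℂ, Differentiable ℂ G ∧ ∀ z, F z = (z - a) ^ n * G z := by
  induction n with
  | zero => intro F hF a _; exact ⟨F, hF, by simp⟩
  | succ n ih =>
    intro F hF a hn
    have hFa : F a = 0 := by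
      rw [← (hF.analyticAt a).analyticOrderAt_ne_zero]
      intro h
      rw [h] at hn
      simp at hn
    have hd : Differentiable ℂ (dslope F a) := by
      rw [← differentiableOn_univ]
      exact (Complex.differentiableOn_dslope Filter.univ_mem).mpr hF.differentiableOn
    have heq : ∀ z, F z = (z - a) * dslope F a z := by
      intro z
      have := sub_smul_dslope F a z
      rw [hFa, sub_zero, smul_eq_mul] at this
      exact this.symm
    have hF' : F = (fun z => z - a) * dslope F a := funext heq
    have hsub : AnalyticAt ℂ (fun z : ℂ => z - a) a := by fun_prop
    have ho : analyticOrderAt (fun z : ℂ => z - a) a = 1 := by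
      have : ((1:ℕ) : ℕ∞) = 1 := rfl
      rw [← this, hsub.analyticOrderAt_eq_natCast]
      exact ⟨fun _ => 1, analyticAt_const, by simp, by simp⟩
    rw [hF', analyticOrderAt_mul hsub (hd.analyticAt a), ho] at hn
    have hn' : (n : ℕ∞) ≤ analyticOrderAt (dslope F a) a := by
      push_cast at hn
      rw [add_comm] at hn
      exact (ENat.add_le_add_iff_left (by simp)).mp hn
    obtain ⟨G, hG, hG'⟩ := ih _ hd a hn'
    exact ⟨G, hG, fun z => by rw [heq, hG']; ring⟩

theorem factor_all (F : ℂ → ℂ) (hF : Differentiable ℂ F) (Δ : ℕ) (R : ℕ)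
    (h : ∀ l < R, (Δ : ℕ∞) ≤ analyticOrderAt F (l : ℂ)) :
    ∃ G : ℂ → ℂ, Differentiable ℂ G ∧ ∀ z, F z = (∏ l ∈ Finset.range R, (z - l) ^ Δ) * G z := by
  induction R with
  | zero => exact ⟨F, hF, by simp⟩
  | succ R ih =>
    obtain ⟨G, hG, hG'⟩ := ih (fun l hl => h l (by omega))
    have hF' : F = (fun z => ∏ l ∈ Finset.range R, (z - (l:ℂ)) ^ Δ) * G := funext hG'
    have hP : Differentiable ℂ (fun z : ℂ => ∏ l ∈ Finset.range R, (z - (l:ℂ)) ^ Δ) := by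
      fun_prop
    have h1 := h R (by omega)
    rw [hF', analyticOrderAt_mul (hP.analyticAt _) (hG.analyticAt _),
      (hP.analyticAt _).analyticOrderAt_eq_zero.mpr, zero_add] at h1
    · obtain ⟨H, hH, hH'⟩ := factor_one Δ G hG R h1
      exact ⟨H, hH, fun z => by rw [hG', hH', Finset.prod_range_succ]; ring⟩
    · rw [Finset.prod_ne_zero_iff]
      intro l hl
      apply pow_ne_zero
      rw [sub_ne_zero]
      have := Finset.mem_range.mp hl
      exact_mod_cast (by omega : R ≠ l)

theorem schwarz (F : ℂ → ℂ) (hF : Differentiable ℂ F) (Δ R R' : ℕ) (hR : R ≤ R')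
    (hz : ∀ l < R, ∀ n < Δ, iteratedDeriv n F (l : ℂ) = 0) (B : ℝ)
    (hB : ∀ z : ℂ, ‖z‖ = 4 * R' → ‖F z‖ ≤ B) (l : ℕ) (hl : l < R') :
    ‖F l‖ * 3 ^ (Δ * R) ≤ B := by
  obtain ⟨G, hG, hG'⟩ := factor_all F hF Δ R (fun l hl =>
    (natCast_le_analyticOrderAt_iff_iteratedDeriv_eq_zero (hF.analyticAt _)).mpr (hz l hl))
  have hR0 : (0:ℝ) < R' := by exact_mod_cast (by omega : 0 < R')
  have hpos : (0:ℝ) < (3 * R') ^ (Δ * R) := by positivity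
  have hlow : ∀ z : ℂ, ‖z‖ = 4 * R' → (3 * R' : ℝ) ^ (Δ * R) ≤
      ‖∏ l ∈ Finset.range R, (z - l) ^ Δ‖ := by
    intro z hz
    rw [norm_prod]
    calc (3 * R' : ℝ) ^ (Δ * R) = ∏ l ∈ Finset.range R, (3 * R' : ℝ) ^ Δ := by
          rw [Finset.prod_const, Finset.card_range, pow_mul]
      _ ≤ _ := by
        refine Finset.prod_le_prod (fun _ _ => by positivity) fun l hl => ?_
        rw [norm_pow]
        gcongr
        have h1 : ‖z‖ - ‖(l:ℂ)‖ ≤ ‖z - l‖ := norm_sub_norm_le _ _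
        have h2 : (l : ℝ) ≤ R' := by
          exact_mod_cast (Finset.mem_range.mp hl).le.trans hR
        rw [hz, Complex.norm_natCast] at h1
        linarith
  have hGb : ∀ z : ℂ, ‖z‖ = 4 * R' → ‖G z‖ ≤ B / (3 * R') ^ (Δ * R) := by
    intro z hz
    rw [le_div_iff₀ hpos]
    have h1 := hB z hz
    rw [hG', norm_mul, mul_comm] at h1
    exact (mul_le_mul_of_nonneg_left (hlow z hz) (norm_nonneg _)).trans h1
  have hGl : ‖G l‖ ≤ B / (3 * R') ^ (Δ * R) := by
    refine Complex.norm_le_of_forall_mem_frontier_norm_le (U := Metric.ball 0 (4 * R'))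
      Metric.isBounded_ball hG.diffContOnCl (fun z hz => hGb z ?_) (subset_closure ?_)
    · rw [frontier_ball _ (by positivity)] at hz
      simpa using hz
    · rw [mem_ball_zero_iff, Complex.norm_natCast]
      have : (l : ℝ) < R' := by exact_mod_cast hl
      linarith
  have hup : ‖∏ k ∈ Finset.range R, ((l:ℂ) - k) ^ Δ‖ ≤ (R' : ℝ) ^ (Δ * R) := by
    rw [norm_prod]
    calc _ ≤ ∏ k ∈ Finset.range R, (R' : ℝ) ^ Δ := by
          refine Finset.prod_le_prod (fun _ _ => by positivity) fun k hk => ?_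
          rw [norm_pow]
          gcongr
          have h2 : k < R' := (Finset.mem_range.mp hk).trans_le hR
          have : ((l:ℂ) - k) = (((l:ℤ) - k : ℤ) : ℂ) := by push_cast; rfl
          rw [this, Complex.norm_intCast]
          have : |(l:ℤ) - k| ≤ R' := by rw [abs_le]; constructor <;> omega
          exact_mod_cast this
      _ = _ := by rw [Finset.prod_const, Finset.card_range, pow_mul]
  rw [le_div_iff₀ hpos] at hGl
  calc ‖F l‖ * 3 ^ (Δ * R) ≤ ((R' : ℝ) ^ (Δ * R) * ‖G l‖) * 3 ^ (Δ * R) := by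
        rw [hG', norm_mul]; gcongr
    _ = ‖G l‖ * (3 * R') ^ (Δ * R) := by rw [mul_pow]; ring
    _ ≤ B := hGl
end pieces
end BakerAux

namespace BakerAux
open Polynomial NumberField

section assembly

/-- The algebraic values. -/
def VV {R ι : Type*} [CommRing R] [Fintype ι] (D : R) (k : ι → ℕ) (p w v g : ι → R)
    (m0 m1 l : ℕ) : R :=
  ∑ i, p i * (ee D (w i) m0 (k i) (l : R) * v i ^ m1 * g i ^ l)

/-- The auxiliary functions. -/
noncomputable def FF {ι : Type*} [Fintype ι] (D : ℂ) (k : ι → ℕ) (p w v ω : ι → ℂ)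
    (m0 m1 : ℕ) (z : ℂ) : ℂ :=
  ∑ i, p i * (ee D (w i) m0 (k i) z * v i ^ m1 * Complex.exp (ω i * z))

theorem VV_map {R S ι : Type*} [CommRing R] [CommRing S] [Fintype ι] (f : R →+* S) (D : R)
    (k : ι → ℕ) (p w v g : ι → R) (m0 m1 l : ℕ) :
    f (VV D k p w v g m0 m1 l) =
      VV (f D) k (fun i => f (p i)) (fun i => f (w i)) (fun i => f (v i)) (fun i => f (g i))
        m0 m1 l := by
  simp [VV, ee_map]

theorem FF_deriv {ι : Type*} [Fintype ι] (D : ℂ) (hD : D ≠ 0) (k : ι → ℕ) (p w v ω : ι → ℂ)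
    (ℓ : ℂ) (hω : ∀ i, D * ω i = w i + ℓ * v i) (m0 m1 : ℕ) (z : ℂ) :
    HasDerivAt (FF D k p w v ω m0 m1)
      (D⁻¹ * FF D k p w v ω (m0 + 1) m1 z + D⁻¹ * ℓ * FF D k p w v ω m0 (m1 + 1) z) z := by
  have h : HasDerivAt (fun z => ∑ i, p i * (ee D (w i) m0 (k i) z * v i ^ m1 *
      Complex.exp (ω i * z))) (∑ i, p i * ((k i * ee D (w i) m0 (k i - 1) z) * v i ^ m1 *
      Complex.exp (ω i * z) + ee D (w i) m0 (k i) z * v i ^ m1 *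
      (Complex.exp (ω i * z) * ω i))) z := by
    refine HasDerivAt.fun_sum fun i _ => ?_
    have h1 := ((ee_deriv D (w i) z m0 (k i)).mul_const (v i ^ m1))
    have h2 : HasDerivAt (fun z => Complex.exp (ω i * z)) (Complex.exp (ω i * z) * ω i) z := by
      simpa using ((hasDerivAt_id z).const_mul (ω i)).cexp
    exact (h1.fun_mul h2).const_mul (p i)
  refine h.congr_deriv ?_
  simp only [FF]
  rw [Finset.mul_sum, Finset.mul_sum, ← Finset.sum_add_distrib]
  refine Finset.sum_congr rfl fun i _ => ?_
  have h3 : ω i = D⁻¹ * (w i + ℓ * v i) := by rw [← hω i]; field_simp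
  generalize Complex.exp (ω i * z) = Ex
  rw [h3, ee]
  field_simp
  ring

theorem FF_iter {ι : Type*} [Fintype ι] (D : ℂ) (hD : D ≠ 0) (k : ι → ℕ) (p w v ω : ι → ℂ)
    (ℓ : ℂ) (hω : ∀ i, D * ω i = w i + ℓ * v i) (S : ℕ) (a : ℂ)
    (h : ∀ m0 m1, m0 + m1 < S → FF D k p w v ω m0 m1 a = 0) (n : ℕ) :
    ∀ m0 m1, n + m0 + m1 < S → iteratedDeriv n (FF D k p w v ω m0 m1) a = 0 := by
  have hdiff : ∀ m0 m1, Differentiable ℂ (FF D k p w v ω m0 m1) := fun m0 m1 z =>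
    (FF_deriv D hD k p w v ω ℓ hω m0 m1 z).differentiableAt
  induction n with
  | zero => intro m0 m1 hm; simpa using h m0 m1 (by omega)
  | succ n ih =>
    intro m0 m1 hm
    have hd : deriv (FF D k p w v ω m0 m1) = fun z => D⁻¹ * FF D k p w v ω (m0 + 1) m1 z +
        D⁻¹ * ℓ * FF D k p w v ω m0 (m1 + 1) z :=
      funext fun z => (FF_deriv D hD k p w v ω ℓ hω m0 m1 z).deriv
    rw [iteratedDeriv_succ', hd, iteratedDeriv_fun_add, iteratedDeriv_const_mul_field,
      iteratedDeriv_const_mul_field, ih _ _ (by omega), ih _ _ (by omega)]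
    · simp
    · exact ((hdiff _ _).const_mul _).contDiff.contDiffAt
    · exact ((hdiff _ _).const_mul _).contDiff.contDiffAt

theorem term_bound (D w v z h : ℂ) (k m0 m1 L S : ℕ) (X Y H : ℝ) (hX : 1 ≤ X) (hz : ‖z‖ ≤ X)
    (hk : k ≤ L) (hY : 1 ≤ Y) (hw : ‖D‖ * k + ‖w‖ ≤ Y) (hv : ‖v‖ ≤ Y) (hh : ‖h‖ ≤ H)
    (hm : m0 + m1 ≤ S) :
    ‖ee D w m0 k z * v ^ m1 * h‖ ≤ X ^ L * Y ^ S * H := by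
  rw [norm_mul, norm_mul, norm_pow]
  have hH : 0 ≤ H := (norm_nonneg _).trans hh
  calc ‖ee D w m0 k z‖ * ‖v‖ ^ m1 * ‖h‖ ≤ ((‖D‖ * k + ‖w‖) ^ m0 * X ^ k) * Y ^ m1 * H := by
        gcongr
        exact ee_bound D w z X hX hz m0 k
    _ ≤ (Y ^ m0 * X ^ L) * Y ^ m1 * H := by gcongr
    _ = X ^ L * Y ^ (m0 + m1) * H := by rw [pow_add]; ring
    _ ≤ X ^ L * Y ^ S * H := by gcongr

theorem house_le {K : Type*} [Field K] [NumberField K] (x : K) (H : ℝ)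
    (h : ∀ σ : K →+* ℂ, ‖σ x‖ ≤ H) : house x ≤ H := by
  have hH : 0 ≤ H := (norm_nonneg _).trans (h (Classical.arbitrary _))
  rw [house]
  exact (pi_norm_le_iff_of_nonneg hH).mpr h

theorem extrapolate {K ι : Type*} [Field K] [NumberField K] [Fintype ι] (φ : K →+* ℂ)
    (D : 𝓞 K) (hD : D ≠ 0) (k : ι → ℕ) (p w v g : ι → 𝓞 K) (ω : ι → ℂ) (ℓ Bc : ℂ)
    (hBc0 : Bc ≠ 0) (hω : ∀ i, φ D * ω i = φ (w i) + ℓ * φ (v i))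
    (hg : ∀ i, φ (g i) = Bc * Complex.exp (ω i))
    (L S0 S Δ R R' : ℕ) (P Y Γ Z : ℝ) (hP : 1 ≤ P) (hY : 1 ≤ Y) (hΓ : 1 ≤ Γ)
    (hp : ∀ i (σ : K →+* ℂ), ‖σ (p i)‖ ≤ P) (hk : ∀ i, k i ≤ L)
    (hw : ∀ i (σ : K →+* ℂ), ‖σ D‖ * k i + ‖σ (w i)‖ ≤ Y)
    (hv : ∀ i (σ : K →+* ℂ), ‖σ (v i)‖ ≤ Y)
    (hgΓ : ∀ i (σ : K →+* ℂ), ‖σ (g i)‖ ≤ Γ) (hBc : ‖Bc‖ ≤ Γ) (hωΓ : ∀ i, Real.exp ‖ω i‖ ≤ Γ)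
    (hR : R ≤ R') (hS : S + Δ ≤ S0) (hι : 1 ≤ Fintype.card ι)
    (hZ : (Fintype.card ι : ℝ) * (P * ((4 * R') ^ L * Y ^ S0 * Γ ^ (4 * R'))) ≤ Z)
    (hlt : Z ^ (Module.finrank ℚ K + 1) < 3 ^ (Δ * R))
    (hvan : ∀ l < R, ∀ m0 m1, m0 + m1 < S + Δ → VV D k p w v g m0 m1 l = 0) :
    ∀ l < R', ∀ m0 m1, m0 + m1 < S → VV D k p w v g m0 m1 l = 0 := by
  intro l hl m0 m1 hm
  by_contra hne
  have hR'1 : (1:ℝ) ≤ R' := by exact_mod_cast (by omega : 1 ≤ R')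
  have hX1 : (1:ℝ) ≤ 4 * R' := by linarith
  have hι' : (1:ℝ) ≤ Fintype.card ι := by exact_mod_cast hι
  have hD' : φ D ≠ 0 := by
    rw [Ne, map_eq_zero]
    exact_mod_cast hD
  -- link between values
  have hlink : ∀ m0 m1 l, φ (VV D k p w v g m0 m1 l : 𝓞 K) = Bc ^ l *
      FF (φ D) k (fun i => φ (p i)) (fun i => φ (w i)) (fun i => φ (v i)) ω m0 m1 l := by
    intro m0 m1 l
    have := VV_map (φ.comp (algebraMap (𝓞 K) K)) D k p w v g m0 m1 l
    refine Eq.trans this ?_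
    simp only [VV, FF, Finset.mul_sum, RingHom.comp_apply]
    refine Finset.sum_congr rfl fun i _ => ?_
    have h1 : φ (algebraMap (𝓞 K) K (g i)) ^ l = Bc ^ l * Complex.exp (ω i * l) := by
      have := hg i
      rw [show φ (algebraMap (𝓞 K) K (g i)) = Bc * Complex.exp (ω i) from hg i, mul_pow,
        ← Complex.exp_nat_mul, mul_comm (l : ℂ)]
    rw [h1]
    ring
  have hFvan : ∀ l < R, ∀ m0 m1, m0 + m1 < S + Δ →
      FF (φ D) k (fun i => φ (p i)) (fun i => φ (w i)) (fun i => φ (v i)) ω m0 m1 l = 0 := by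
    intro l hl m0 m1 hm
    have h1 := hlink m0 m1 l
    rw [hvan l hl m0 m1 hm] at h1
    have h2 : φ ((0 : 𝓞 K) : K) = 0 := by simp
    rw [h2] at h1
    exact (mul_eq_zero.mp h1.symm).resolve_left (pow_ne_zero _ hBc0)
  have hdiff : Differentiable ℂ
      (FF (φ D) k (fun i => φ (p i)) (fun i => φ (w i)) (fun i => φ (v i)) ω m0 m1) := fun z =>
    (FF_deriv (φ D) hD' k _ _ _ ω ℓ hω m0 m1 z).differentiableAt
  have hFl := schwarz _ hdiff Δ R R' hR (fun l hl n hn =>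
    FF_iter (φ D) hD' k _ _ _ ω ℓ hω (S + Δ) (l : ℂ) (hFvan l hl) n m0 m1 (by omega)) Z (by
      intro z hz
      refine le_trans ?_ hZ
      refine (norm_sum_le _ _).trans ?_
      rw [← nsmul_eq_mul, ← Finset.card_univ]
      refine Finset.sum_le_card_nsmul _ _ _ fun i _ => ?_
      rw [norm_mul]
      refine mul_le_mul (hp i φ) ?_ (norm_nonneg _) (by linarith)
      refine term_bound _ _ _ _ _ _ _ _ L S0 (4 * R') Y _ hX1 hz.le (hk i) hY (hw i φ) (hv i φ)
        ?_ (by omega)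
      rw [Complex.norm_exp]
      calc Real.exp (ω i * z).re ≤ Real.exp (‖ω i‖ * (4 * R')) := by
            apply Real.exp_le_exp.mpr
            refine (Complex.re_le_norm _).trans ?_
            rw [norm_mul, hz]
        _ = Real.exp ‖ω i‖ ^ (4 * R') := by
            rw [← Real.exp_nat_mul]; push_cast; ring_nf
        _ ≤ Γ ^ (4 * R') := by
            have := hωΓ i
            gcongr) l hl
  have hhouse : house ((VV D k p w v g m0 m1 l : 𝓞 K) : K) ≤ Z := by
    refine house_le _ _ fun σ => ?_
    have h1 := VV_map (σ.comp (algebraMap (𝓞 K) K)) D k p w v g m0 m1 l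
    have h2 : σ ((VV D k p w v g m0 m1 l : 𝓞 K) : K) =
      (σ.comp (algebraMap (𝓞 K) K)) (VV D k p w v g m0 m1 l) := rfl
    rw [h2, h1]
    refine le_trans ?_ hZ
    refine (norm_sum_le _ _).trans ?_
    rw [← nsmul_eq_mul, ← Finset.card_univ]
    refine Finset.sum_le_card_nsmul _ _ _ fun i _ => ?_
    rw [norm_mul]
    refine mul_le_mul (hp i σ) ?_ (norm_nonneg _) (by linarith)
    refine term_bound _ _ _ _ _ _ _ _ L S0 (4 * R') Y _ hX1 ?_ (hk i) hY (hw i σ) (hv i σ)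
        ?_ (by omega)
    · rw [Complex.norm_natCast]
      have : (l : ℝ) ≤ R' := by exact_mod_cast hl.le
      linarith
    · rw [norm_pow]
      calc _ ≤ Γ ^ l := by
            have : ‖(σ.comp (algebraMap (𝓞 K) K)) (g i)‖ ≤ Γ := hgΓ i σ
            gcongr
        _ ≤ Γ ^ (4 * R') := pow_le_pow_right₀ hΓ (by omega)
  have hli := liouville φ _ hne Z hhouse
  rw [hlink, norm_mul, norm_pow] at hli
  have hΓZ : Γ ^ R' ≤ Z := by
    refine le_trans ?_ hZ
    have h1 : (1:ℝ) ≤ (4 * R' : ℝ) ^ L := one_le_pow₀ hX1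
    have h2 : (1:ℝ) ≤ Y ^ S0 := one_le_pow₀ hY
    have h3 : Γ ^ R' ≤ Γ ^ (4 * R') := pow_le_pow_right₀ hΓ (by omega)
    have h4 : 0 ≤ Γ ^ (4 * R') := by positivity
    have h5 := one_le_mul_of_one_le_of_one_le hι' (one_le_mul_of_one_le_of_one_le hP
      (one_le_mul_of_one_le_of_one_le h1 h2))
    calc Γ ^ R' ≤ 1 * Γ ^ (4 * R') := by rw [one_mul]; exact h3
      _ ≤ _ := mul_le_mul_of_nonneg_right h5 h4
      _ = _ := by ring
  have hZ0 : 0 ≤ Z := le_trans (by positivity) hΓZ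
  set f := ‖FF (φ D) k (fun i => φ (p i)) (fun i => φ (w i)) (fun i => φ (v i)) ω m0 m1 l‖
  have hf : 0 ≤ f := norm_nonneg _
  have hB : ‖Bc‖ ^ l ≤ Z := by
    refine le_trans ?_ hΓZ
    calc ‖Bc‖ ^ l ≤ Γ ^ l := by gcongr
      _ ≤ Γ ^ R' := pow_le_pow_right₀ hΓ hl.le
  have hfr : 1 ≤ Module.finrank ℚ K := Module.finrank_pos
  refine absurd hlt (not_lt.mpr ?_)
  calc (3:ℝ) ^ (Δ * R) = 3 ^ (Δ * R) * 1 := by ring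
    _ ≤ 3 ^ (Δ * R) * (‖Bc‖ ^ l * f * Z ^ (Module.finrank ℚ K - 1)) := by gcongr
    _ = (f * 3 ^ (Δ * R)) * (‖Bc‖ ^ l) * Z ^ (Module.finrank ℚ K - 1) := by ring
    _ ≤ Z * Z * Z ^ (Module.finrank ℚ K - 1) := by gcongr
    _ = Z ^ (Module.finrank ℚ K + 1) := by
      rw [← pow_two, ← pow_add]; congr 1; omega

theorem final {R ι : Type*} [CommRing R] [IsDomain R] [CharZero R] [Fintype ι] [DecidableEq R]
    (D : R) (k : ι → ℕ) (p w v g : ι → R) (L M N : ℕ)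
    (hinj : ∀ i j, k i = k j → w i = w j → g i = g j → i = j)
    (hg : ∀ i, g i ≠ 0) (hk : ∀ i, k i < L)
    (hw : (Finset.univ.image w).card ≤ M) (hgN : (Finset.univ.image g).card * L ≤ N)
    (hvan : ∀ l < N, ∀ m0 < M, VV D k p w v g m0 0 l = 0) : ∀ i, p i = 0 := by
  classical
  have step1 : ∀ m0 < M, ∀ τ ∈ Finset.univ.image g,
      ∑ i with g i = τ, C (p i) * ee (C D) (C (w i)) m0 (k i) (X : R[X]) = 0 := by
    intro m0 hm0
    refine zero_lemma N (Finset.univ.image g)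
      (fun τ => ∑ i with g i = τ, C (p i) * ee (C D) (C (w i)) m0 (k i) (X : R[X]))
      (fun _ => L) ?_ ?_ ?_ ?_
    · simp only [Finset.mem_image, not_exists, not_and]
      exact fun i _ => hg i
    · intro τ _
      refine (degree_sum_le _ _).trans_lt ?_
      rw [Finset.sup_lt_iff (by exact WithBot.bot_lt_coe _)]
      intro i _
      refine (degree_C_mul_le' _ _).trans_lt ((ee_natDegree D (w i) m0 (k i)).trans_lt ?_)
      exact_mod_cast hk i
    · simpa using hgN
    · intro j hj
      rw [← hvan j hj m0 hm0, VV,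
        ← Finset.sum_fiberwise_of_maps_to (s := Finset.univ) (t := Finset.univ.image g) (g := g)
          (fun i _ => Finset.mem_image_of_mem g (Finset.mem_univ i))]
      refine Finset.sum_congr rfl fun τ _ => ?_
      rw [eval_finsetSum, Finset.sum_mul]
      refine Finset.sum_congr rfl fun i hi => ?_
      have := (Finset.mem_filter.mp hi).2
      have he := ee_map (evalRingHom (j : R)) (C D) (C (w i)) m0 (k i) X
      simp only [coe_evalRingHom, eval_C, eval_X] at he
      rw [eval_mul, eval_C, he, this]
      ring
  intro i
  have step2 := separate (R := R) (V := R[X]) (D • (derivative : Module.End R R[X])) M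
    (Finset.univ.image w)
    (fun u => ∑ j ∈ (Finset.univ.filter (fun j => g j = g i)).filter (fun j => w j = u),
      p j • X ^ (k j)) hw (by
      intro m hm
      have h := step1 m hm (g i) (Finset.mem_image_of_mem g (Finset.mem_univ i))
      rw [← Finset.sum_fiberwise_of_maps_to (t := Finset.univ.image w) (g := w)
          (fun i _ => Finset.mem_image_of_mem w (Finset.mem_univ i))] at h
      rw [← h]
      refine Finset.sum_congr rfl fun u _ => ?_
      rw [map_sum]
      refine Finset.sum_congr rfl fun j hj => ?_
      have hju := (Finset.mem_filter.mp hj).2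
      rw [map_smul, ee_poly, smul_eq_C_mul, hju]) (w i)
      (Finset.mem_image_of_mem w (Finset.mem_univ i))
  have h3 := congrArg (fun q => coeff q (k i)) step2
  simp only [finsetSum_coeff, coeff_smul, coeff_X_pow, coeff_zero] at h3
  rw [Finset.sum_eq_single i] at h3
  · simpa using h3
  · intro j hj hji
    simp only [Finset.mem_filter, Finset.mem_univ, true_and] at hj
    have : k i ≠ k j := fun h => hji (hinj j i h.symm hj.2 hj.1)
    simp [this]
  · intro h
    exact absurd (by simp) h

end assembly
end BakerAux

namespace BakerAux
open Polynomial NumberField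

section core

theorem numeric (c : ℝ) (d : ℕ) :
    ∃ t : ℕ, 72 ≤ t ∧ (c * (t : ℝ) ^ 667) ^ (d + 1) < 3 ^ t := by
  have h := tendsto_pow_const_div_const_pow_of_one_lt (667 * (d + 1)) (r := (3 : ℝ)) (by norm_num)
  have h2 := (h.const_mul (c ^ (d + 1)))
  rw [mul_zero] at h2
  have h3 := (h2.eventually (gt_mem_nhds (zero_lt_one' ℝ))).and (Filter.eventually_ge_atTop 72)
  obtain ⟨t, ht, ht2⟩ := h3.exists
  refine ⟨t, ht2, ?_⟩
  rw [← mul_div_assoc, div_lt_one (by positivity)] at ht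
  rw [mul_pow, ← pow_mul]
  exact ht

theorem Zbound (c E G : ℝ) (hc : 1 ≤ c) (hE : 1 ≤ E) (hG : 1 ≤ G) (t R : ℕ) (ht : 1 ≤ t)
    (hR : t ≤ R) (hR' : t ^ 9 * R ≤ t ^ 46) :
    ((t ^ 46 : ℕ) : ℝ) * ((c * (c * ((t ^ 46 : ℕ) : ℝ) * ((t : ℝ) ^ (t ^ 22) *
      (E * t ^ 22) ^ (12 * t ^ 22) * (G ^ (t ^ 12)) ^ t))) *
      ((4 * ((t ^ 9 * R : ℕ) : ℝ)) ^ (t ^ 22) * (E * t ^ 22) ^ (12 * t ^ 22) *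
        (G ^ (t ^ 12)) ^ (4 * (t ^ 9 * R)))) ≤
      ((4 * c ^ 2 * E ^ 24 * G ^ 5) * (t : ℝ) ^ 667) ^ (t ^ 21 * R) := by
  set U := t ^ 21 * R with hU
  have hU1 : 1 ≤ U := Nat.mul_pos (pow_pos ht _) (ht.trans hR)
  have hUM : t ^ 22 ≤ U := by
    rw [hU, pow_succ]; exact Nat.mul_le_mul_left _ hR
  have t1 : (1:ℝ) ≤ t := by exact_mod_cast ht
  have hY : (1:ℝ) ≤ E * t ^ 22 := one_le_mul_of_one_le_of_one_le hE (one_le_pow₀ t1)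
  have f1 : ((t ^ 46 : ℕ) : ℝ) ≤ ((t:ℝ) ^ 46) ^ U := by
    push_cast
    exact le_self_pow₀ (one_le_pow₀ t1) (by omega)
  have f2 : c * c ≤ (c ^ 2) ^ U := by
    rw [← pow_two]
    exact le_self_pow₀ (one_le_pow₀ hc) (by omega)
  have f3 : (t : ℝ) ^ (t ^ 22) ≤ (t : ℝ) ^ U := pow_le_pow_right₀ t1 hUM
  have f4 : (E * t ^ 22) ^ (12 * t ^ 22) ≤ ((E * (t : ℝ) ^ 22) ^ 12) ^ U := by
    rw [pow_mul]
    exact pow_le_pow_right₀ (one_le_pow₀ hY) hUM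
  have f5 : (G ^ (t ^ 12)) ^ t ≤ G ^ U := by
    rw [← pow_mul]
    apply pow_le_pow_right₀ hG
    refine le_trans ?_ hUM
    rw [← pow_succ]
    exact Nat.pow_le_pow_right ht (by norm_num)
  have f6 : (4 * ((t ^ 9 * R : ℕ) : ℝ)) ^ (t ^ 22) ≤ (4 * (t : ℝ) ^ 46) ^ U := by
    have h1 : ((t ^ 9 * R : ℕ) : ℝ) ≤ (t : ℝ) ^ 46 := by exact_mod_cast hR'
    calc _ ≤ (4 * (t : ℝ) ^ 46) ^ (t ^ 22) := by gcongr
      _ ≤ _ := by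
        apply pow_le_pow_right₀ _ hUM
        have : (1:ℝ) ≤ (t : ℝ) ^ 46 := one_le_pow₀ t1
        linarith
  have f7 : (G ^ (t ^ 12)) ^ (4 * (t ^ 9 * R)) = (G ^ 4) ^ U := by
    rw [← pow_mul, ← pow_mul, hU]
    congr 1
    ring
  have hc0 : 0 ≤ c := by linarith
  have hE0 : 0 ≤ E := by linarith
  have hG0 : 0 ≤ G := by linarith
  rw [f7]
  calc _ = ((t ^ 46 : ℕ) : ℝ) * (((c * c) * ((t ^ 46 : ℕ) : ℝ) * ((t : ℝ) ^ (t ^ 22) *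
      (E * t ^ 22) ^ (12 * t ^ 22) * (G ^ (t ^ 12)) ^ t)) *
      ((4 * ((t ^ 9 * R : ℕ) : ℝ)) ^ (t ^ 22) * (E * t ^ 22) ^ (12 * t ^ 22) *
        (G ^ 4) ^ U)) := by ring
    _ ≤ ((t:ℝ) ^ 46) ^ U * (((c ^ 2) ^ U * ((t:ℝ) ^ 46) ^ U * ((t : ℝ) ^ U *
      ((E * (t : ℝ) ^ 22) ^ 12) ^ U * G ^ U)) *
      ((4 * (t : ℝ) ^ 46) ^ U * ((E * (t : ℝ) ^ 22) ^ 12) ^ U * (G ^ 4) ^ U)) := by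
        gcongr
    _ = _ := by
      simp only [← mul_pow]
      congr 1
      ring

theorem core {K : Type*} [Field K] [NumberField K] (φ : K →+* ℂ) (b0 b1 : K)
    (A1 B1 A2 B2 : ℤ) (hA1 : A1 ≠ 0) (hB1 : B1 ≠ 0) (hA2 : A2 ≠ 0) (hB2 : B2 ≠ 0) (ℓ θ : ℂ)
    (h1 : B1 * Complex.exp ℓ = A1) (h2 : B2 * Complex.exp θ = A2)
    (hn : ∀ n : ℕ, n ≠ 0 → A1 ^ n ≠ B1 ^ n) (hθ : θ = φ b0 + φ b1 * ℓ) : b0 = 0 := by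
  classical
  by_contra hb0
  -- common denominator
  obtain ⟨D, c0, c1, hD, hc0, hc1⟩ : ∃ D c0 c1 : 𝓞 K, D ≠ 0 ∧ (D : K) * b0 = c0 ∧
      (D : K) * b1 = c1 := by
    obtain ⟨x0, y0, hy0, e0⟩ := IsFractionRing.div_surjective (A := 𝓞 K) b0
    obtain ⟨x1, y1, hy1, e1⟩ := IsFractionRing.div_surjective (A := 𝓞 K) b1
    have hy0' : y0 ≠ 0 := nonZeroDivisors.ne_zero hy0
    have hy1' : y1 ≠ 0 := nonZeroDivisors.ne_zero hy1
    have k0 : algebraMap (𝓞 K) K y0 ≠ 0 := by simpa using hy0'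
    have k1 : algebraMap (𝓞 K) K y1 ≠ 0 := by simpa using hy1'
    refine ⟨y0 * y1, x0 * y1, x1 * y0, mul_ne_zero hy0' hy1', ?_, ?_⟩
    · change algebraMap (𝓞 K) K (y0 * y1) * b0 = algebraMap (𝓞 K) K (x0 * y1)
      rw [← e0, map_mul, map_mul]; field_simp
    · change algebraMap (𝓞 K) K (y0 * y1) * b1 = algebraMap (𝓞 K) K (x1 * y0)
      rw [← e1, map_mul, map_mul]; field_simp
  have hDK : (D : K) ≠ 0 := by simpa using hD
  have hc0ne : c0 ≠ 0 := by
    intro h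
    have hz : ((0 : 𝓞 K) : K) = 0 := map_zero (algebraMap (𝓞 K) K)
    rw [h, hz] at hc0
    exact (mul_ne_zero hDK hb0) hc0
  obtain ⟨c, hc, hsiegel⟩ := siegel K
  set E : ℝ := house (D : K) + house (c0 : K) + house (c1 : K) + 1 with hEdef
  have hD0 := house_nonneg (D : K)
  have hc00 := house_nonneg (c0 : K)
  have hc10 := house_nonneg (c1 : K)
  have hE : 1 ≤ E := by linarith
  set q : ℝ := |(A1:ℝ)| + |(B1:ℝ)| + |(A2:ℝ)| + |(B2:ℝ)| with hq
  have hqA1 : |(A1:ℝ)| ≤ q := by rw [hq]; linarith [abs_nonneg (B1:ℝ), abs_nonneg (A2:ℝ), abs_nonneg (B2:ℝ)]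
  have hqB1 : |(B1:ℝ)| ≤ q := by rw [hq]; linarith [abs_nonneg (A1:ℝ), abs_nonneg (A2:ℝ), abs_nonneg (B2:ℝ)]
  have hqA2 : |(A2:ℝ)| ≤ q := by rw [hq]; linarith [abs_nonneg (B1:ℝ), abs_nonneg (A1:ℝ), abs_nonneg (B2:ℝ)]
  have hqB2 : |(B2:ℝ)| ≤ q := by rw [hq]; linarith [abs_nonneg (B1:ℝ), abs_nonneg (A2:ℝ), abs_nonneg (A1:ℝ)]
  have hq1 : 1 ≤ q := by
    refine le_trans ?_ hqA1
    exact_mod_cast Int.one_le_abs hA1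
  set Ex : ℝ := Real.exp (‖ℓ‖ + ‖θ‖) with hEx
  have hEx1 : 1 ≤ Ex := Real.one_le_exp (by positivity)
  set G : ℝ := q ^ 2 * Ex with hG
  have hqG : q ^ 2 ≤ G := le_mul_of_one_le_right (by positivity) hEx1
  have hExG : Ex ≤ G := le_mul_of_one_le_left (by positivity) (one_le_pow₀ hq1)
  have hG1 : 1 ≤ G := hEx1.trans hExG
  obtain ⟨t, ht72, htlt⟩ := numeric (4 * c ^ 2 * E ^ 24 * G ^ 5) (Module.finrank ℚ K)
  have ht1 : 1 ≤ t := by omega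
  have t1 : (1:ℝ) ≤ t := by exact_mod_cast ht1
  -- data
  set L := t ^ 12 with hL
  let ι := Fin (t ^ 22) × Fin L × Fin L
  have hcard : Fintype.card ι = t ^ 46 := by
    simp only [ι, Fintype.card_prod, Fintype.card_fin, hL]; ring
  let k : ι → ℕ := fun i => i.1
  let w : ι → 𝓞 K := fun i => c0 * ((i.2.2 : ℕ) : 𝓞 K)
  let v : ι → 𝓞 K := fun i => D * ((i.2.1 : ℕ) : 𝓞 K) + c1 * ((i.2.2 : ℕ) : 𝓞 K)
  let gg : ℕ → ℕ → ℤ := fun a b => A1 ^ a * B1 ^ (L - a) * (A2 ^ b * B2 ^ (L - b))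
  let g : ι → 𝓞 K := fun i => ((gg i.2.1 i.2.2 : ℤ) : 𝓞 K)
  let ω : ι → ℂ := fun i => (i.2.1 : ℕ) * ℓ + (i.2.2 : ℕ) * θ
  let Bc : ℂ := (B1 : ℂ) ^ L * (B2 : ℂ) ^ L
  have hBc0 : Bc ≠ 0 :=
    mul_ne_zero (pow_ne_zero _ (by exact_mod_cast hB1)) (pow_ne_zero _ (by exact_mod_cast hB2))
  have hφθ : φ D * θ = φ c0 + ℓ * φ c1 := by
    rw [hθ, mul_add, ← hc0, ← hc1, map_mul, map_mul]; ring
  have hω : ∀ i, φ D * ω i = φ (w i) + ℓ * φ (v i) := by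
    intro i
    have e1 : φ (w i) = φ c0 * (i.2.2 : ℕ) := by simp [w]
    have e2 : φ (v i) = φ D * (i.2.1 : ℕ) + φ c1 * (i.2.2 : ℕ) := by simp [v]
    rw [e1, e2]
    linear_combination ((i.2.2 : ℕ) : ℂ) * hφθ
  have hgφ : ∀ i, φ (g i) = Bc * Complex.exp (ω i) := by
    intro i
    have e1 : φ (g i) = (gg i.2.1 i.2.2 : ℂ) := by simp [g]
    have ha : (i.2.1 : ℕ) ≤ L := i.2.1.2.le
    have hb : (i.2.2 : ℕ) ≤ L := i.2.2.2.le
    rw [e1]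
    simp only [gg, Bc, ω]
    rw [Complex.exp_add, Complex.exp_nat_mul, Complex.exp_nat_mul]
    push_cast
    rw [← h1, ← h2, mul_pow, mul_pow, ← pow_sub_mul_pow (B1 : ℂ) ha, ← pow_sub_mul_pow (B2 : ℂ) hb]
    ring
  set Y : ℝ := E * t ^ 22 with hYdef
  have hY : 1 ≤ Y := one_le_mul_of_one_le_of_one_le hE (one_le_pow₀ t1)
  set Γ : ℝ := G ^ L with hΓdef
  have hΓ : 1 ≤ Γ := one_le_pow₀ hG1
  have hL22 : (L : ℝ) ≤ (t : ℝ) ^ 22 := by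
    rw [hL]; push_cast; exact pow_le_pow_right₀ t1 (by norm_num)
  have hk : ∀ i, k i ≤ t ^ 22 := fun i => i.1.2.le
  have hw : ∀ i (σ : K →+* ℂ), ‖σ D‖ * k i + ‖σ (w i)‖ ≤ Y := by
    intro i σ
    have e1 : ‖σ (w i)‖ = ‖σ c0‖ * (i.2.2 : ℕ) := by simp [w]
    have n1 := norm_embedding_le_house (D : K) σ
    have n2 := norm_embedding_le_house (c0 : K) σ
    have n3 : (k i : ℝ) ≤ (t : ℝ) ^ 22 := by exact_mod_cast hk i
    have n4 : ((i.2.2 : ℕ) : ℝ) ≤ (t : ℝ) ^ 22 := by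
      refine le_trans ?_ hL22
      exact_mod_cast i.2.2.2.le
    rw [e1]
    calc _ ≤ house (D : K) * (t : ℝ) ^ 22 + house (c0 : K) * (t : ℝ) ^ 22 := by gcongr
      _ = (house (D : K) + house (c0 : K)) * (t : ℝ) ^ 22 := by ring
      _ ≤ Y := by rw [hYdef]; gcongr; linarith
  have hv : ∀ i (σ : K →+* ℂ), ‖σ (v i)‖ ≤ Y := by
    intro i σ
    have e1 : σ (v i) = σ D * (i.2.1 : ℕ) + σ c1 * (i.2.2 : ℕ) := by simp [v]
    have n1 := norm_embedding_le_house (D : K) σ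
    have n2 := norm_embedding_le_house (c1 : K) σ
    have n3 : ((i.2.1 : ℕ) : ℝ) ≤ (t : ℝ) ^ 22 := by
      refine le_trans ?_ hL22
      exact_mod_cast i.2.1.2.le
    have n4 : ((i.2.2 : ℕ) : ℝ) ≤ (t : ℝ) ^ 22 := by
      refine le_trans ?_ hL22
      exact_mod_cast i.2.2.2.le
    rw [e1]
    refine (norm_add_le _ _).trans ?_
    rw [norm_mul, norm_mul, Complex.norm_natCast, Complex.norm_natCast]
    calc _ ≤ house (D : K) * (t : ℝ) ^ 22 + house (c1 : K) * (t : ℝ) ^ 22 := by gcongr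
      _ = (house (D : K) + house (c1 : K)) * (t : ℝ) ^ 22 := by ring
      _ ≤ Y := by rw [hYdef]; gcongr; linarith
  have hpowle : ∀ (x y : ℤ) (a : ℕ), a ≤ L → |(x:ℝ)| ≤ q → |(y:ℝ)| ≤ q →
      |(x:ℝ)| ^ a * |(y:ℝ)| ^ (L - a) ≤ q ^ L := by
    intro x y a ha hx hy
    calc _ ≤ q ^ a * q ^ (L - a) := by gcongr
      _ = q ^ L := by rw [← pow_add]; congr 1; omega
  have hgΓ : ∀ i (σ : K →+* ℂ), ‖σ (g i)‖ ≤ Γ := by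
    intro i σ
    have e1 : σ (g i) = (gg i.2.1 i.2.2 : ℂ) := by simp [g]
    rw [e1]
    have e2 : ‖(gg i.2.1 i.2.2 : ℂ)‖ = |(A1:ℝ)| ^ (i.2.1 : ℕ) * |(B1:ℝ)| ^ (L - (i.2.1 : ℕ)) *
        (|(A2:ℝ)| ^ (i.2.2 : ℕ) * |(B2:ℝ)| ^ (L - (i.2.2 : ℕ))) := by
      simp [gg]
    rw [e2]
    calc _ ≤ q ^ L * q ^ L := by
          gcongr
          · exact hpowle _ _ _ i.2.1.2.le hqA1 hqB1
          · exact hpowle _ _ _ i.2.2.2.le hqA2 hqB2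
      _ = (q ^ 2) ^ L := by rw [← pow_mul, ← pow_add]; congr 1; ring
      _ ≤ Γ := by rw [hΓdef]; gcongr
  have hBcΓ : ‖Bc‖ ≤ Γ := by
    have : ‖Bc‖ = |(B1:ℝ)| ^ L * |(B2:ℝ)| ^ L := by simp [Bc]
    rw [this]
    calc _ ≤ q ^ L * q ^ L := by gcongr
      _ = (q ^ 2) ^ L := by rw [← pow_mul, ← pow_add]; congr 1; ring
      _ ≤ Γ := by rw [hΓdef]; gcongr
  have hωΓ : ∀ i, Real.exp ‖ω i‖ ≤ Γ := by
    intro i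
    have n3 : ((i.2.1 : ℕ) : ℝ) ≤ L := by exact_mod_cast i.2.1.2.le
    have n4 : ((i.2.2 : ℕ) : ℝ) ≤ L := by exact_mod_cast i.2.2.2.le
    calc Real.exp ‖ω i‖ ≤ Real.exp (L * (‖ℓ‖ + ‖θ‖)) := by
          apply Real.exp_le_exp.mpr
          refine (norm_add_le _ _).trans ?_
          rw [norm_mul, norm_mul, Complex.norm_natCast, Complex.norm_natCast, mul_add]
          gcongr
      _ = Ex ^ L := by rw [Real.exp_nat_mul]
      _ ≤ Γ := by rw [hΓdef]; gcongr
  -- Siegel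
  set A : ℝ := (t : ℝ) ^ (t ^ 22) * Y ^ (12 * t ^ 22) * Γ ^ t with hAdef
  have hA : 1 ≤ A := one_le_mul_of_one_le_of_one_le
    (one_le_mul_of_one_le_of_one_le (one_le_pow₀ t1) (one_le_pow₀ hY)) (one_le_pow₀ hΓ)
  obtain ⟨p, hp0, hpeq, hpb⟩ := hsiegel (Fin t × Fin (6 * t ^ 22) × Fin (6 * t ^ 22)) ι
    (fun a i => ee D (w i) a.2.1 (k i) ((a.1 : ℕ) : 𝓞 K) * v i ^ (a.2.2 : ℕ) * g i ^ (a.1 : ℕ))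
    A hA (by
      intro a i
      refine house_le _ _ fun σ => ?_
      have e1 : σ (((ee D (w i) a.2.1 (k i) ((a.1 : ℕ) : 𝓞 K) * v i ^ (a.2.2 : ℕ) *
          g i ^ (a.1 : ℕ) : 𝓞 K)) : K) = ee (σ D) (σ (w i)) a.2.1 (k i) ((a.1 : ℕ) : ℂ) *
          σ (v i) ^ (a.2.2 : ℕ) * σ (g i) ^ (a.1 : ℕ) := by
        have := ee_map (σ.comp (algebraMap (𝓞 K) K)) D (w i) a.2.1 (k i) ((a.1 : ℕ) : 𝓞 K)
        change (σ.comp (algebraMap (𝓞 K) K)) (ee D (w i) a.2.1 (k i) ((a.1 : ℕ) : 𝓞 K) *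
          v i ^ (a.2.2 : ℕ) * g i ^ (a.1 : ℕ)) = _
        rw [map_mul, map_mul, map_pow, map_pow, this, map_natCast]
        rfl
      rw [e1]
      refine term_bound _ _ _ _ _ _ _ _ (t ^ 22) (12 * t ^ 22) t Y _ t1 ?_ (hk i) hY (hw i σ)
        (hv i σ) ?_ ?_
      · rw [Complex.norm_natCast]; exact_mod_cast a.1.2.le
      · rw [norm_pow]
        calc _ ≤ Γ ^ (a.1 : ℕ) := by have := hgΓ i σ; gcongr
          _ ≤ Γ ^ t := pow_le_pow_right₀ hΓ a.1.2.le
      · have := a.2.1.2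
        have := a.2.2.2
        omega)
    (by
      simp only [Fintype.card_prod, Fintype.card_fin]
      positivity)
    (by
      rw [hcard]
      simp only [Fintype.card_prod, Fintype.card_fin]
      calc 2 * (t * (6 * t ^ 22 * (6 * t ^ 22))) = 72 * t ^ 45 := by ring
        _ ≤ t * t ^ 45 := Nat.mul_le_mul_right _ ht72
        _ = t ^ 46 := by ring)
  rw [hcard] at hpb
  set P : ℝ := c * (c * ((t ^ 46 : ℕ) : ℝ) * A) with hPdef
  have hP : 1 ≤ P := by
    refine one_le_mul_of_one_le_of_one_le hc (one_le_mul_of_one_le_of_one_le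
      (one_le_mul_of_one_le_of_one_le hc ?_) hA)
    exact_mod_cast Nat.one_le_pow _ _ ht1
  have hp : ∀ i (σ : K →+* ℂ), ‖σ (p i)‖ ≤ P := fun i σ =>
    (norm_embedding_le_house _ σ).trans (hpb i)
  have hind : ∀ J ≤ 5, ∀ l < t ^ (1 + 9 * J), ∀ m0 m1, m0 + m1 < (6 - J) * t ^ 22 →
      VV D k p w v g m0 m1 l = 0 := by
    intro J
    induction J with
    | zero =>
      intro _ l hl m0 m1 hm
      simp only [mul_zero, add_zero, pow_one, Nat.sub_zero] at hl hm
      have := congrFun hpeq (⟨l, hl⟩, ⟨m0, by omega⟩, ⟨m1, by omega⟩)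
      simp only [Matrix.mulVec, dotProduct, Pi.zero_apply] at this
      rw [← this, VV]
      exact Finset.sum_congr rfl fun i _ => mul_comm _ _
    | succ J ih =>
      intro hJ
      have hR' : t ^ (1 + 9 * (J + 1)) = t ^ 9 * t ^ (1 + 9 * J) := by
        rw [← pow_add]; congr 1; ring
      have htR : t ≤ t ^ (1 + 9 * J) := by
        calc t = t ^ 1 := (pow_one t).symm
          _ ≤ _ := Nat.pow_le_pow_right ht1 (by omega)
      have hle46 : t ^ 9 * t ^ (1 + 9 * J) ≤ t ^ 46 := by
        rw [← pow_add]; exact Nat.pow_le_pow_right ht1 (by omega)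
      have hsum : (6 - (J + 1)) * t ^ 22 + t ^ 22 = (6 - J) * t ^ 22 := by
        have : 6 - J = (6 - (J + 1)) + 1 := by omega
        rw [this]; ring
      have hZ := Zbound c E G hc hE hG1 t (t ^ (1 + 9 * J)) ht1 htR hle46
      rw [hR']
      refine extrapolate φ D hD k p w v g ω ℓ Bc hBc0 hω hgφ (t ^ 22) (12 * t ^ 22)
        ((6 - (J + 1)) * t ^ 22) (t ^ 22) (t ^ (1 + 9 * J)) (t ^ 9 * t ^ (1 + 9 * J)) P Y Γ
        (((4 * c ^ 2 * E ^ 24 * G ^ 5) * (t : ℝ) ^ 667) ^ (t ^ 21 * t ^ (1 + 9 * J)))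
        hP hY hΓ hp hk hw hv hgΓ hBcΓ hωΓ ?_ ?_ ?_ (by rw [hcard]; exact hZ) ?_ ?_
      · exact Nat.le_mul_of_pos_left _ (pow_pos ht1 _)
      · rw [hsum]; exact Nat.mul_le_mul_right _ (by omega)
      · rw [hcard]; exact Nat.one_le_pow _ _ ht1
      · rw [← pow_mul, mul_comm _ (Module.finrank ℚ K + 1), pow_mul]
        calc _ < ((3:ℝ) ^ t) ^ (t ^ 21 * t ^ (1 + 9 * J)) := by
              apply pow_lt_pow_left₀ htlt (by positivity)
              positivity
          _ = _ := by rw [← pow_mul]; congr 1; ring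
      · rw [hsum]; exact ih (by omega)
  have hfin := final D k p w v g (t ^ 22) (t ^ 22) (t ^ 46) ?_ ?_ (fun i => i.1.2) ?_ ?_ ?_
  · exact hp0 (funext hfin)
  · intro i j hkij hwij hgij
    have e0 : i.1 = j.1 := Fin.ext hkij
    have e2 : (i.2.2 : ℕ) = (j.2.2 : ℕ) := by
      have := mul_left_cancel₀ hc0ne hwij
      exact_mod_cast this
    have hgij' : gg i.2.1 i.2.2 = gg j.2.1 j.2.2 := by
      have : ((gg i.2.1 i.2.2 : ℤ) : 𝓞 K) = ((gg j.2.1 j.2.2 : ℤ) : 𝓞 K) := hgij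
      exact_mod_cast this
    have key : ∀ a b : ℕ, a < b → b ≤ L → A1 ^ a * B1 ^ (L - a) ≠ A1 ^ b * B1 ^ (L - b) := by
      intro a b hab hb h
      have r1 : L - a = (L - b) + (b - a) := by omega
      have r2 : A1 ^ b = A1 ^ a * A1 ^ (b - a) := by rw [← pow_add]; congr 1; omega
      rw [r1, r2, pow_add] at h
      have h' : (A1 ^ a * B1 ^ (L - b)) * A1 ^ (b - a) = (A1 ^ a * B1 ^ (L - b)) * B1 ^ (b - a) := by
        linear_combination -h
      exact hn (b - a) (by omega)
        (mul_left_cancel₀ (mul_ne_zero (pow_ne_zero _ hA1) (pow_ne_zero _ hB1)) h')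
    simp only [gg, e2] at hgij'
    have hgij'' := mul_right_cancel₀ (mul_ne_zero (pow_ne_zero _ hA2) (pow_ne_zero _ hB2)) hgij'
    have e1 : (i.2.1 : ℕ) = (j.2.1 : ℕ) := by
      rcases lt_trichotomy (i.2.1 : ℕ) (j.2.1 : ℕ) with h | h | h
      · exact absurd hgij'' (key _ _ h j.2.1.2.le)
      · exact h
      · exact absurd hgij''.symm (key _ _ h i.2.1.2.le)
    exact Prod.ext e0 (Prod.ext (Fin.ext e1) (Fin.ext e2))
  · intro i
    have : gg i.2.1 i.2.2 ≠ 0 := mul_ne_zero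
      (mul_ne_zero (pow_ne_zero _ hA1) (pow_ne_zero _ hB1))
      (mul_ne_zero (pow_ne_zero _ hA2) (pow_ne_zero _ hB2))
    exact Int.cast_ne_zero.mpr this
  · calc (Finset.univ.image w).card ≤
          ((Finset.univ : Finset (Fin L)).image (fun b : Fin L => c0 * ((b : ℕ) : 𝓞 K))).card := by
          apply Finset.card_le_card
          intro x hx
          obtain ⟨i, _, rfl⟩ := Finset.mem_image.mp hx
          exact Finset.mem_image.mpr ⟨i.2.2, Finset.mem_univ _, rfl⟩
      _ ≤ (Finset.univ : Finset (Fin L)).card := Finset.card_image_le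
      _ = t ^ 12 := by simp [hL]
      _ ≤ t ^ 22 := Nat.pow_le_pow_right ht1 (by norm_num)
  · calc (Finset.univ.image g).card * t ^ 22 ≤ t ^ 24 * t ^ 22 := by
          apply Nat.mul_le_mul_right
          calc (Finset.univ.image g).card ≤ ((Finset.univ : Finset (Fin L × Fin L)).image
                (fun b : Fin L × Fin L => ((gg b.1 b.2 : ℤ) : 𝓞 K))).card := by
                apply Finset.card_le_card
                intro x hx
                obtain ⟨i, _, rfl⟩ := Finset.mem_image.mp hx
                exact Finset.mem_image.mpr ⟨i.2, Finset.mem_univ _, rfl⟩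
            _ ≤ (Finset.univ : Finset (Fin L × Fin L)).card := Finset.card_image_le
            _ = t ^ 24 := by
              simp only [Finset.card_univ, Fintype.card_prod, Fintype.card_fin, hL]; ring
      _ = t ^ 46 := by ring
  · intro l hl m0 hm0
    exact hind 5 le_rfl l (by simpa using hl) m0 0 (by simpa using hm0)

end core
end BakerAux

namespace BakerAux

theorem core_alg (b0 b1 : ℂ) (hb0 : IsAlgebraic ℚ b0) (hb1 : IsAlgebraic ℚ b1)
    (A1 B1 A2 B2 : ℤ) (hA1 : A1 ≠ 0) (hB1 : B1 ≠ 0) (hA2 : A2 ≠ 0) (hB2 : B2 ≠ 0) (ℓ θ : ℂ)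
    (h1 : B1 * Complex.exp ℓ = A1) (h2 : B2 * Complex.exp θ = A2)
    (hn : ∀ n : ℕ, n ≠ 0 → A1 ^ n ≠ B1 ^ n) (hθ : θ = b0 + b1 * ℓ) : b0 = 0 := by
  let F := IntermediateField.adjoin ℚ ({b0, b1} : Set ℂ)
  have hfd : FiniteDimensional ℚ F := by
    apply IntermediateField.finiteDimensional_adjoin
    intro x hx
    rcases hx with rfl | hx
    · exact hb0.isIntegral
    · rw [Set.mem_singleton_iff] at hx
      rw [hx]; exact hb1.isIntegral
  have hnf : NumberField F := ⟨⟩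
  have m0 : b0 ∈ F := IntermediateField.subset_adjoin _ _ (by simp)
  have m1 : b1 ∈ F := IntermediateField.subset_adjoin _ _ (by simp)
  have := core (K := F) (algebraMap F ℂ) ⟨b0, m0⟩ ⟨b1, m1⟩ A1 B1 A2 B2 hA1 hB1 hA2 hB2 ℓ θ h1 h2 hn hθ
  exact congrArg Subtype.val this

theorem two_log (a : ℤ) (M N : ℕ) (hM : 0 < M) (hN : 0 < N) (β : ℝ) (hβ : IsAlgebraic ℚ β)
    (h : β = a * (Real.pi / 4) + (1 / 2) * (Real.log M - Real.log N)) : β = 0 := by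
  have hβC : IsAlgebraic ℚ (β : ℂ) := hβ.algebraMap
  have hI : IsAlgebraic ℚ Complex.I :=
    ⟨Polynomial.X ^ 2 + 1, (Polynomial.monic_X_pow_add_C (1 : ℚ) two_ne_zero).ne_zero, by simp⟩
  have hMC : ((M : ℤ) : ℂ) ≠ 0 := by exact_mod_cast hM.ne'
  have hNC : ((N : ℤ) : ℂ) ≠ 0 := by exact_mod_cast hN.ne'
  have hIntAlg : ∀ z : ℤ, IsAlgebraic ℚ (z : ℂ) := fun z => isAlgebraic_intCast z
  have hexp : ((N : ℤ) : ℂ) * Complex.exp ((Real.log M - Real.log N : ℝ) : ℂ) = ((M : ℤ) : ℂ) := by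
    rw [← Complex.ofReal_exp, Real.exp_sub, Real.exp_log (by exact_mod_cast hM),
      Real.exp_log (by exact_mod_cast hN)]
    push_cast at *
    field_simp
  have h2e : ((1 : ℤ) : ℂ) * Complex.exp ((Real.log 2 : ℝ) : ℂ) = ((2 : ℤ) : ℂ) := by
    rw [← Complex.ofReal_exp, Real.exp_log (by norm_num)]
    norm_num
  have h2n : ∀ n : ℕ, n ≠ 0 → (2 : ℤ) ^ n ≠ 1 ^ n := by
    intro n hn
    rw [one_pow]
    exact (one_lt_pow₀ (by norm_num) hn).ne'
  have hpi : ((1 : ℤ) : ℂ) * Complex.exp (Real.pi * Complex.I) = ((-1 : ℤ) : ℂ) := by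
    rw [Complex.exp_pi_mul_I]; norm_num
  have hMz : (M : ℤ) ≠ 0 := by exact_mod_cast hM.ne'
  have hNz : (N : ℤ) ≠ 0 := by exact_mod_cast hN.ne'
  by_cases ha : a = 0
  · have := core_alg (2 * β) 0 ((hIntAlg 2).mul hβC) isAlgebraic_zero 2 1 M N (by norm_num)
      (by norm_num) hMz hNz _ _ h2e hexp h2n (by rw [h, ha]; push_cast; ring)
    have h0 : (β : ℂ) = 0 := by simpa using this
    exact_mod_cast h0
  · have haC : (a : ℂ) ≠ 0 := by exact_mod_cast ha
    have hb0 : IsAlgebraic ℚ ((4 : ℤ) * (β : ℂ) * Complex.I * (a : ℂ)⁻¹) :=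
      (((hIntAlg 4).mul hβC).mul hI).mul (hIntAlg a).inv
    have hb1 : IsAlgebraic ℚ ((-2 : ℤ) * Complex.I * (a : ℂ)⁻¹) :=
      ((hIntAlg (-2)).mul hI).mul (hIntAlg a).inv
    have hz : (4 : ℤ) * (β : ℂ) * Complex.I * (a : ℂ)⁻¹ = 0 := by
      by_cases hMN : M = N
      · subst hMN
        refine core_alg _ 0 hb0 isAlgebraic_zero 2 1 (-1) 1 (by norm_num)
          (by norm_num) (by norm_num) (by norm_num) _ _ h2e hpi h2n ?_
        rw [h]; push_cast; field_simp; ring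
      · refine core_alg _ _ hb0 hb1 M N (-1) 1 hMz hNz (by norm_num) (by norm_num) _ _ hexp hpi ?_ ?_
        · intro n hn hc
          have hc' : M ^ n = N ^ n := by exact_mod_cast hc
          exact hMN (Nat.pow_left_injective hn hc')
        · rw [h]; push_cast; field_simp; ring
    have h0 : (β : ℂ) = 0 := by simpa [haC, Complex.I_ne_zero] using hz
    exact_mod_cast h0

end BakerAux

theorem transcendental_of_ne_log_deriv
    (K L : Type*) [Field K] [NumberField K] [Field L] [NumberField L]
    (xK xL : ℝ)
    (hxK : xK = (1 / 2) * ((NumberField.InfinitePlace.nrRealPlaces K : ℝ) * (Real.pi / 2) +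
      (Module.finrank ℚ K : ℝ) * (Real.log (8 * Real.pi) + Real.eulerMascheroniConstant) -
      Real.log |(NumberField.discr K : ℝ)|))
    (hxL : xL = (1 / 2) * ((NumberField.InfinitePlace.nrRealPlaces L : ℝ) * (Real.pi / 2) +
      (Module.finrank ℚ L : ℝ) * (Real.log (8 * Real.pi) + Real.eulerMascheroniConstant) -
      Real.log |(NumberField.discr L : ℝ)|))
    (hne : (Module.finrank ℚ L : ℝ) * xK ≠ (Module.finrank ℚ K : ℝ) * xL) :
    Transcendental ℚ xK ∨ Transcendental ℚ xL := by
  by_contra hcon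
  unfold Transcendental at hcon
  push Not at hcon
  obtain ⟨aK, aL⟩ := hcon
  have hIntAlg : ∀ z : ℕ, IsAlgebraic ℚ (z : ℝ) := fun z => isAlgebraic_natCast z
  have hlog : ∀ (z : ℤ) (n : ℕ), Real.log ((z.natAbs ^ n : ℕ) : ℝ) = n * Real.log |(z : ℝ)| := by
    intro z n
    rw [Nat.cast_pow, Real.log_pow, Nat.cast_natAbs, Int.cast_abs]
  have key := BakerAux.two_log
    ((Module.finrank ℚ L : ℤ) * NumberField.InfinitePlace.nrRealPlaces K -
      (Module.finrank ℚ K : ℤ) * NumberField.InfinitePlace.nrRealPlaces L)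
    ((NumberField.discr L).natAbs ^ Module.finrank ℚ K)
    ((NumberField.discr K).natAbs ^ Module.finrank ℚ L)
    (pow_pos (Int.natAbs_pos.mpr (NumberField.discr_ne_zero L)) _)
    (pow_pos (Int.natAbs_pos.mpr (NumberField.discr_ne_zero K)) _)
    ((Module.finrank ℚ L : ℝ) * xK - (Module.finrank ℚ K : ℝ) * xL)
    (((hIntAlg _).mul aK).sub ((hIntAlg _).mul aL))
    (by rw [hlog, hlog, hxK, hxL]; push_cast; ring)
  exact hne (sub_eq_zero.mp key)
end
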